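/- arXiv:1008.2043 — 3 statements merged into one kernel-verified Lean document; each statement's English description precedes it below -/
import Mathlib

section
/- For each of the primes n = 787, 823, 883, 1063, 1303, 2143, 3533, 5441, 5449, 8237, 8573, there exists a Hadamard matrix of order 4n. -/
/-- A Hadamard matrix of order `n`: entries `±1` and `H * Hᵀ = n • I`. -/
def IsHadamard (n : ℕ) (H : Matrix (Fin n) (Fin n) ℤ) : Prop :=
  (∀ i j, H i j = 1 ∨ H i j = -1) ∧ H * H.transpose = (n : ℤ) • 1

/-- A conference matrix of order `n`: zero diagonal, off-diagonal entries `±1`,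
and `C * Cᵀ = (n - 1) • I`. -/
def IsConference (n : ℕ) (C : Matrix (Fin n) (Fin n) ℤ) : Prop :=
  (∀ i, C i i = 0) ∧ (∀ i j, i ≠ j → C i j = 1 ∨ C i j = -1) ∧
    C * C.transpose = ((n : ℤ) - 1) • 1

/-- There is a Hadamard matrix of order `n`. -/
def HasHadamard (n : ℕ) : Prop := ∃ H : Matrix (Fin n) (Fin n) ℤ, IsHadamard n H

theorem hasHadamard_of_rows {ι κ : Type} [Fintype ι] [Fintype κ] [DecidableEq ι] {n : ℕ}
    (hι : Fintype.card ι = n) (hκ : Fintype.card κ = n) (H : ι → κ → ℤ)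
    (h1 : ∀ i j, H i j = 1 ∨ H i j = -1)
    (h2 : ∀ i k, ∑ j, H i j * H k j = if i = k then (n : ℤ) else 0) : HasHadamard n := by
  let e := (Fintype.equivFinOfCardEq hι).symm
  let f := (Fintype.equivFinOfCardEq hκ).symm
  refine ⟨Matrix.of fun i j => H (e i) (f j), fun i j => h1 _ _, ?_⟩
  ext i k
  rw [Matrix.mul_apply]
  simp only [Matrix.transpose_apply, Matrix.of_apply, Matrix.smul_apply, Matrix.one_apply]
  rw [Equiv.sum_comp f (fun j => H (e i) j * H (e k) j), h2]
  simp

theorem IsHadamard.sum_row {n : ℕ} {H : Matrix (Fin n) (Fin n) ℤ} (h : IsHadamard n H)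
    (i k : Fin n) : ∑ j, H i j * H k j = if i = k then (n : ℤ) else 0 := by
  have := congrFun (congrFun h.2 i) k
  rw [Matrix.mul_apply] at this
  simpa [Matrix.one_apply] using this

theorem IsHadamard.sum_col {n : ℕ} {H : Matrix (Fin n) (Fin n) ℤ} (h : IsHadamard n H)
    (i k : Fin n) : ∑ j, H j i * H j k = if i = k then (n : ℤ) else 0 := by
  have hn : (n : ℤ) ≠ 0 := by
    have := i.pos
    positivity
  have h0 : H * (H.transpose * H - (n : ℤ) • 1) = 0 := by
    rw [mul_sub, ← mul_assoc, h.2, Matrix.smul_mul, Matrix.mul_smul, one_mul, mul_one, sub_self]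
  have hd : H.det ≠ 0 := by
    intro h0
    have := congrArg Matrix.det h.2
    rw [Matrix.det_mul, h0, zero_mul, Matrix.det_smul, Matrix.det_one] at this
    exact pow_ne_zero (Fintype.card (Fin n)) hn (by simpa using this.symm)
  have h3 : H.transpose * H - (n : ℤ) • 1 = 0 := by
    have := congrArg (H.adjugate * ·) h0
    simp only [← mul_assoc, Matrix.adjugate_mul, mul_zero, Matrix.smul_mul, one_mul] at this
    exact (smul_eq_zero.1 this).resolve_left hd
  have := congrFun (congrFun (sub_eq_zero.1 h3) i) k
  rw [Matrix.mul_apply] at this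
  simpa [Matrix.one_apply] using this

theorem HasHadamard.two_mul {n : ℕ} (h : HasHadamard n) : HasHadamard (2 * n) := by
  obtain ⟨H, hH⟩ := h
  have h1 := hH.1
  have h2 := hH.sum_row
  refine hasHadamard_of_rows (ι := Bool × Fin n) (κ := Bool × Fin n) (by simp) (by simp)
    (fun x y => (if x.1 && y.1 then -1 else 1) * H x.2 y.2) ?_ ?_
  · rintro ⟨a, i⟩ ⟨b, j⟩
    rcases h1 i j with h | h <;> simp only [h] <;> split_ifs <;> simp
  · rintro ⟨a, i⟩ ⟨c, k⟩
    rw [Fintype.sum_prod_type]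
    have := h2 i k
    cases a <;> cases c <;> simp [this, Prod.ext_iff, ← _root_.two_mul]

/-- A conference matrix `C` with `Cᵀ = ε C`, as rows indexed by a finite type. -/
structure IsSignedConference {ι : Type} [Fintype ι] [DecidableEq ι] (ε : ℤ) (C : ι → ι → ℤ) :
    Prop where
  diag : ∀ i, C i i = 0
  off : ∀ i j, i ≠ j → C i j = 1 ∨ C i j = -1
  symm : ∀ i j, C j i = ε * C i j
  orth : ∀ i k, ∑ j, C i j * C k j = if i = k then (Fintype.card ι : ℤ) - 1 else 0

/-- The core of a conference matrix: zero diagonal, `±1` elsewhere, `Sᵀ = ε S`, vanishing row sums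
and `S * Sᵀ = n • I - J`. -/
structure IsCore {ι : Type} [Fintype ι] [DecidableEq ι] (ε : ℤ) (S : ι → ι → ℤ) : Prop where
  diag : ∀ i, S i i = 0
  off : ∀ i j, i ≠ j → S i j = 1 ∨ S i j = -1
  symm : ∀ i j, S j i = ε * S i j
  row : ∀ i, ∑ j, S i j = 0
  orth : ∀ i k, ∑ j, S i j * S k j = (if i = k then (Fintype.card ι : ℤ) else 0) - 1

/-- There is a core of order `n` and sign `ε`. -/
def HasCore (ε : ℤ) (n : ℕ) : Prop := ∃ S : Fin n → Fin n → ℤ, IsCore ε S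

/-- There is a skew conference matrix of order `n`. -/
def HasSkewConference (n : ℕ) : Prop := ∃ C : Fin n → Fin n → ℤ, IsSignedConference (-1) C

section

variable {ι κ : Type} [Fintype ι] [DecidableEq ι] [Fintype κ] [DecidableEq κ] {ε : ℤ}

theorem IsSignedConference.reindex {C : ι → ι → ℤ} (h : IsSignedConference ε C) (e : κ ≃ ι) :
    IsSignedConference ε fun i j => C (e i) (e j) where
  diag i := h.diag _
  off i j hij := h.off _ _ (by simpa using hij)
  symm i j := h.symm _ _
  orth i k := by
    rw [Equiv.sum_comp e fun j => C (e i) j * C (e k) j, h.orth, Fintype.card_congr e]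
    simp

theorem IsCore.reindex {S : ι → ι → ℤ} (h : IsCore ε S) (e : κ ≃ ι) :
    IsCore ε fun i j => S (e i) (e j) where
  diag i := h.diag _
  off i j hij := h.off _ _ (by simpa using hij)
  symm i j := h.symm _ _
  row i := by rw [Equiv.sum_comp e fun j => S (e i) j, h.row]
  orth i k := by
    rw [Equiv.sum_comp e fun j => S (e i) j * S (e k) j, h.orth, Fintype.card_congr e]
    simp

theorem IsSignedConference.hasSkewConference {C : ι → ι → ℤ} (h : IsSignedConference (-1) C)
    {n : ℕ} (hn : Fintype.card ι = n) : HasSkewConference n :=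
  ⟨_, h.reindex (Fintype.equivFinOfCardEq hn).symm⟩

theorem IsCore.hasCore {S : ι → ι → ℤ} (h : IsCore ε S) {n : ℕ} (hn : Fintype.card ι = n) :
    HasCore ε n :=
  ⟨_, h.reindex (Fintype.equivFinOfCardEq hn).symm⟩

theorem HasCore.exists_isCore {n : ℕ} (h : HasCore ε n) (ι : Type) [Fintype ι] [DecidableEq ι]
    (hn : Fintype.card ι = n) : ∃ S : ι → ι → ℤ, IsCore ε S := by
  obtain ⟨S, hS⟩ := h
  exact ⟨_, hS.reindex (Fintype.equivFinOfCardEq hn)⟩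

theorem HasCore.exists_conference {n : ℕ} (h : HasCore ε n) (hε : ε * ε = 1) :
    ∃ C : Option (Fin n) → Option (Fin n) → ℤ, IsSignedConference ε C := by
  obtain ⟨S, hS⟩ := h
  have hε' : ε = 1 ∨ ε = -1 := mul_self_eq_one_iff.1 hε
  refine ⟨fun i j => i.elim (j.elim 0 fun _ => 1) fun i => j.elim ε fun j => S i j, ?_, ?_, ?_, ?_⟩
  · rintro (_ | i)
    · rfl
    · exact hS.diag i
  · rintro (_ | i) (_ | j) h
    · simp at h
    · simp
    · exact hε'
    · exact hS.off i j (by simpa using h)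
  · rintro (_ | i) (_ | j)
    · simp
    · simp
    · simp [hε]
    · exact hS.symm i j
  · rintro (_ | i) (_ | k)
    · simp
    · simp [hS.row]
    · simp [hS.row]
    · simp [hS.orth, hε]

theorem HasCore.hasHadamard_of_skew {n : ℕ} (h : HasCore (-1) n) : HasHadamard (n + 1) := by
  obtain ⟨C, hC⟩ := h.exists_conference (by norm_num)
  refine hasHadamard_of_rows (ι := Option (Fin n)) (κ := Option (Fin n)) (by simp) (by simp)
    (fun i j => C i j + if i = j then 1 else 0) ?_ ?_
  · intro i j
    by_cases h : i = j
    · simp [h, hC.diag]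
    · simpa [h] using hC.off i j h
  · intro i k
    have h1 := hC.symm i k
    simp only [add_mul, mul_add, Finset.sum_add_distrib, hC.orth, mul_ite, ite_mul, mul_one,
      one_mul, mul_zero, zero_mul, Finset.sum_ite_eq, Finset.mem_univ, if_true, h1,
      Fintype.card_option, Fintype.card_fin]
    by_cases h : i = k
    · simp [h]
    · simp [h]

theorem HasCore.hasHadamard_of_symmetric {n : ℕ} (h : HasCore 1 n) :
    HasHadamard (2 * (n + 1)) := by
  obtain ⟨C, hC⟩ := h.exists_conference (by norm_num)
  refine hasHadamard_of_rows (ι := Bool × Option (Fin n)) (κ := Bool × Option (Fin n))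
    (by simp) (by simp)
    (fun x y => (if x.1 && y.1 then -1 else 1) * C x.2 y.2 +
      (if x.1 || y.1 then -1 else 1) * if x.2 = y.2 then 1 else 0) ?_ ?_
  · rintro ⟨a, i⟩ ⟨b, j⟩
    by_cases h : i = j
    · cases a <;> cases b <;> simp [h, hC.diag]
    · rcases hC.off i j h with h' | h' <;> cases a <;> cases b <;> simp [h, h']
  · rintro ⟨a, i⟩ ⟨c, k⟩
    have h1 := hC.symm i k
    rw [Fintype.sum_prod_type, Fintype.sum_bool]
    cases a <;> cases c <;>
    simp only [Bool.and_true, Bool.and_false, Bool.or_true, Bool.or_false, if_true, add_mul,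
      mul_add, Finset.sum_add_distrib, Finset.sum_neg_distrib, neg_mul,
      mul_neg, Bool.false_eq_true,
      if_false, hC.orth, mul_ite, ite_mul, mul_one,
      one_mul, mul_zero, zero_mul, Finset.sum_ite_eq, Finset.mem_univ, h1,
      Fintype.card_option, Fintype.card_fin] <;>
    by_cases h : i = k <;> simp [h, hC.diag] <;> ring

end

theorem HasSkewConference.two_mul {n : ℕ} (h : HasSkewConference n) :
    HasSkewConference (2 * n) := by
  obtain ⟨S, hS⟩ := h
  have key : IsSignedConference (-1) (ι := Bool × Fin n) fun x y =>
      (if x.1 && y.1 then -1 else 1) * S x.2 y.2 +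
      (if x.1 = y.1 then 0 else if x.1 then -1 else 1) * if x.2 = y.2 then 1 else 0 := by
    refine ⟨?_, ?_, ?_, ?_⟩
    · rintro ⟨a, i⟩
      simp [hS.diag]
    · rintro ⟨a, i⟩ ⟨b, j⟩ hij
      by_cases h : i = j
      · cases a <;> cases b <;> simp [h, hS.diag] at hij ⊢
      · rcases hS.off i j h with h' | h' <;> cases a <;> cases b <;> simp [h, h']
    · rintro ⟨a, i⟩ ⟨b, j⟩
      simp only [hS.symm i j, eq_comm (a := j), eq_comm (a := b)]
      cases a <;> cases b <;> simp only [] <;> by_cases h : i = j <;> simp [h] <;> ring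
    · rintro ⟨a, i⟩ ⟨c, k⟩
      have h1 := hS.symm i k
      rw [Fintype.sum_prod_type, Fintype.sum_bool]
      cases a <;> cases c <;>
      simp only [Bool.and_true, Bool.and_false, if_true, add_mul,
        mul_add, Finset.sum_add_distrib, Finset.sum_neg_distrib, neg_mul,
        mul_neg, neg_neg, Bool.false_eq_true, reduceCtorEq,
        if_false, hS.orth, mul_ite, ite_mul, mul_one,
        one_mul, mul_zero, zero_mul, Finset.sum_ite_eq, Finset.mem_univ, h1,
        Fintype.card_fin] <;>
      by_cases h : i = k <;> simp [h, hS.diag] <;> ring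
  exact key.hasSkewConference (by simp)

theorem HasSkewConference.hasCore {n : ℕ} (h : HasSkewConference (n + 1)) : HasCore (-1) n := by
  obtain ⟨W, hW⟩ := h
  have hd (j : Fin n) : W 0 j.succ * W 0 j.succ = 1 :=
    mul_self_eq_one_iff.2 (hW.off _ _ (Fin.succ_ne_zero j).symm)
  refine ⟨fun j k => W 0 j.succ * W 0 k.succ * W j.succ k.succ, ?_, ?_, ?_, ?_, ?_⟩
  · simp [hW.diag]
  · intro j k hjk
    have := mul_self_eq_one_iff.2 (hW.off j.succ k.succ (by simpa using hjk))
    refine mul_self_eq_one_iff.1 ?_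
    linear_combination (W 0 j.succ * W 0 j.succ * W 0 k.succ * W 0 k.succ) * this +
      W 0 j.succ * W 0 j.succ * hd k + hd j
  · intro j k
    rw [hW.symm j.succ k.succ]
    ring
  · intro j
    have := hW.orth 0 j.succ
    rw [Fin.sum_univ_succ, hW.diag, if_neg (Fin.succ_ne_zero j).symm] at this
    simp only [mul_assoc, ← Finset.mul_sum]
    simp only [zero_mul, zero_add] at this
    rw [this, mul_zero]
  · intro j k
    have := hW.orth j.succ k.succ
    rw [Fin.sum_univ_succ, hW.symm 0 j.succ, hW.symm 0 k.succ] at this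
    have h2 : ∀ l : Fin n, W 0 j.succ * W 0 l.succ * W j.succ l.succ *
        (W 0 k.succ * W 0 l.succ * W k.succ l.succ) =
        W 0 j.succ * W 0 k.succ * (W j.succ l.succ * W k.succ l.succ) := fun l => by
      linear_combination (W 0 j.succ * W 0 k.succ * (W j.succ l.succ * W k.succ l.succ)) * hd l
    simp only [h2, ← Finset.mul_sum]
    have h3 := hd j
    by_cases h : j = k
    · subst h
      simp only [if_true, Fintype.card_fin, Nat.cast_add, Nat.cast_one] at this ⊢
      linear_combination (W 0 j.succ * W 0 j.succ) * this + (n - 1 - W 0 j.succ * W 0 j.succ) * h3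
    · simp only [h, Fin.succ_inj, if_false] at this ⊢
      linear_combination (W 0 j.succ * W 0 k.succ) * this -
        (W 0 j.succ * W 0 j.succ) * hd k - h3

section

variable {F : Type} [Field F] [Fintype F] [DecidableEq F]

theorem sum_quadraticChar_mul_add (hF : ringChar F ≠ 2) {c : F} (hc : c ≠ 0) :
    ∑ t, quadraticChar F t * quadraticChar F (t + c) = -1 := by
  have hχ := quadraticChar_ne_one hF
  have h1 := jacobiSum_nontrivial_inv hχ
  rw [(quadraticChar_isQuadratic F).inv, jacobiSum] at h1
  have hm : quadraticChar F (-1) * quadraticChar F (-1) = 1 := by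
    rw [← map_mul]
    simp
  have hcc : quadraticChar F c * quadraticChar F c = 1 := by
    rw [← sq]
    exact quadraticChar_sq_one hc
  rw [← Equiv.sum_comp (Equiv.mulLeft₀ (-c) (neg_ne_zero.2 hc))]
  have (x : F) : quadraticChar F (-c * x) * quadraticChar F (-c * x + c) =
      quadraticChar F (-1) * (quadraticChar F x * quadraticChar F (1 - x)) := by
    rw [show -c * x + c = c * (1 - x) by ring, show -c * x = -1 * c * x by ring]
    simp only [map_mul]
    linear_combination quadraticChar F (-1) * (quadraticChar F x * quadraticChar F (1 - x)) * hcc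
  simp only [Equiv.mulLeft₀_apply, this, ← Finset.mul_sum, h1]
  linear_combination -hm

theorem isCore_quadraticChar (hF : ringChar F ≠ 2) :
    IsCore (quadraticChar F (-1)) fun x y : F => quadraticChar F (x - y) where
  diag := by simp
  off x y h := quadraticChar_dichotomy (sub_ne_zero.2 h)
  symm x y := by rw [← map_mul]; ring_nf
  row x := by
    refine (Equiv.sum_comp (Equiv.subLeft x) fun t => quadraticChar F t).trans ?_
    exact quadraticChar_sum_zero hF
  orth x y := by
    rw [← Equiv.sum_comp (Equiv.subLeft x)]
    simp only [Equiv.subLeft_apply, sub_sub_cancel]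
    have (t : F) : y - (x - t) = t + (y - x) := by ring
    simp only [this]
    by_cases h : x = y
    · subst h
      have (t : F) : quadraticChar F t * quadraticChar F t = if t = 0 then 0 else 1 := by
        split_ifs with h
        · simp [h]
        · rw [← sq]
          exact quadraticChar_sq_one h
      simp only [sub_self, add_zero, this]
      simp [Finset.sum_ite, Finset.filter_ne', Finset.card_erase_of_mem]
      rw [Nat.cast_sub Fintype.card_pos]
      simp
    · rw [sum_quadraticChar_mul_add hF (sub_ne_zero.2 (Ne.symm h)), if_neg h]
      norm_num

end

theorem hasCore_of_prime {p : ℕ} (hp : p.Prime) (h2 : p ≠ 2) : HasCore (ZMod.χ₄ p) p := by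
  have := Fact.mk hp
  have h := isCore_quadraticChar (F := ZMod p) (by rwa [ZMod.ringChar_zmod_n])
  rw [quadraticChar_neg_one (by rwa [ZMod.ringChar_zmod_n]), ZMod.card] at h
  exact h.hasCore (ZMod.card p)

section

variable {G : Type} [AddCommGroup G] [Fintype G] [DecidableEq G]

/-- The rows of the Goethals–Seidel array built from four sequences. -/
def goethalsSeidel (a b c d : G → ℤ) (u v : Fin 4 × G) : ℤ :=
  !![a (v.2 - u.2), b (-u.2 - v.2), c (-u.2 - v.2), d (-u.2 - v.2);
    -b (-u.2 - v.2), a (v.2 - u.2), d (u.2 + v.2), -c (u.2 + v.2);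
    -c (-u.2 - v.2), -d (u.2 + v.2), a (v.2 - u.2), b (u.2 + v.2);
    -d (-u.2 - v.2), c (u.2 + v.2), -b (u.2 + v.2), a (v.2 - u.2)] u.1 v.1

theorem goethalsSeidel_orth {a b c d : G → ℤ} {w : ℤ}
    (h : ∀ s, ∑ z, a z * a (z + s) + ∑ z, b z * b (z + s) + ∑ z, c z * c (z + s) +
      ∑ z, d z * d (z + s) = if s = 0 then w else 0) (u v : Fin 4 × G) :
    ∑ t, goethalsSeidel a b c d u t * goethalsSeidel a b c d v t = if u = v then w else 0 := by
  obtain ⟨i, x⟩ := u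
  obtain ⟨k, x'⟩ := v
  let K (f g : G → ℤ) (s : G) : ℤ := ∑ z, f z * g (z + s)
  let L (f g : G → ℤ) (s : G) : ℤ := ∑ z, f z * g (s - z)
  have hL (f g : G → ℤ) (s : G) : L f g s = L g f s := by
    simp only [L]
    rw [← Equiv.sum_comp (Equiv.subLeft s)]
    simp [mul_comm]
  have hPP (f g : G → ℤ) (x x' : G) : ∑ y, f (y - x) * g (y - x') = K f g (x - x') := by
    refine Fintype.sum_equiv (Equiv.subRight x) _ _ fun y => ?_
    simp only [Equiv.subRight_apply]
    congr 2
    abel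
  have hMM (f g : G → ℤ) (x x' : G) : ∑ y, f (-x - y) * g (-x' - y) = K f g (x - x') := by
    refine Fintype.sum_equiv (Equiv.subLeft (-x)) _ _ fun y => ?_
    simp only [Equiv.subLeft_apply]
    congr 2
    abel
  have hSS (f g : G → ℤ) (x x' : G) : ∑ y, f (x + y) * g (x' + y) = K g f (x - x') := by
    refine Fintype.sum_equiv (Equiv.addLeft x') _ _ fun y => ?_
    simp only [Equiv.coe_addLeft]
    rw [mul_comm]
    congr 2
    abel
  have hPM (f g : G → ℤ) (x x' : G) : ∑ y, f (y - x) * g (-x' - y) = L f g (-x - x') := by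
    refine Fintype.sum_equiv (Equiv.subRight x) _ _ fun y => ?_
    simp only [Equiv.subRight_apply]
    congr 2
    abel
  have hMP (f g : G → ℤ) (x x' : G) : ∑ y, f (-x - y) * g (y - x') = L g f (-x - x') := by
    rw [← neg_add', add_comm, neg_add', ← hPM]
    simp [mul_comm]
  have hPS (f g : G → ℤ) (x x' : G) : ∑ y, f (y - x) * g (x' + y) = K f g (x + x') := by
    refine Fintype.sum_equiv (Equiv.subRight x) _ _ fun y => ?_
    simp only [Equiv.subRight_apply]
    congr 2
    abel
  have hSP (f g : G → ℤ) (x x' : G) : ∑ y, f (x + y) * g (y - x') = K g f (x + x') := by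
    rw [add_comm x x', ← hPS]
    simp [mul_comm]
  have hMS (f g : G → ℤ) (x x' : G) : ∑ y, f (-x - y) * g (x' + y) = L f g (x' - x) := by
    refine Fintype.sum_equiv (Equiv.subLeft (-x)) _ _ fun y => ?_
    simp only [Equiv.subLeft_apply]
    congr 2
    abel
  have hSM (f g : G → ℤ) (x x' : G) : ∑ y, f (x + y) * g (-x' - y) = L g f (x - x') := by
    rw [← hMS]
    simp [mul_comm]
  have hK : K a a (x - x') + K b b (x - x') + K c c (x - x') + K d d (x - x') =
      if x = x' then w else 0 := by
    simp only [← sub_eq_zero (a := x)]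
    exact h _
  rw [Fintype.sum_prod_type, Fin.sum_univ_four]
  fin_cases i <;> fin_cases k <;>
  simp [goethalsSeidel, hPP, hMM, hSS, hPM, hMP, hPS, hSP, hMS, hSM, hL c b, hL d c, hL d b,
    ← hK] <;> ring

theorem goethalsSeidel_sign {A : Type} [AddCommGroup A] {a b c d : A → ℤ} (ha : ∀ z, a z = 1 ∨ a z = -1)
    (hb : ∀ z, b z = 1 ∨ b z = -1) (hc : ∀ z, c z = 1 ∨ c z = -1) (hd : ∀ z, d z = 1 ∨ d z = -1)
    (u v : Fin 4 × A) :
    goethalsSeidel a b c d u v = 1 ∨ goethalsSeidel a b c d u v = -1 := by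
  obtain ⟨i, x⟩ := u
  obtain ⟨k, y⟩ := v
  have hn {z : ℤ} (h : z = 1 ∨ z = -1) : -z = 1 ∨ -z = -1 := by omega
  fin_cases i <;> fin_cases k <;> simp only [goethalsSeidel] <;>
  first
  | exact ha _ | exact hb _ | exact hc _ | exact hd _
  | exact hn (hb _) | exact hn (hc _) | exact hn (hd _)

theorem isSignedConference_goethalsSeidel {a b c d : G → ℤ}
    (h : ∀ s, ∑ z, a z * a (z + s) + ∑ z, b z * b (z + s) + ∑ z, c z * c (z + s) +
      ∑ z, d z * d (z + s) = if s = 0 then 4 * (Fintype.card G : ℤ) else 0)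
    (ha : ∀ z, a z = 1 ∨ a z = -1) (hb : ∀ z, b z = 1 ∨ b z = -1)
    (hc : ∀ z, c z = 1 ∨ c z = -1) (hd : ∀ z, d z = 1 ∨ d z = -1)
    (hskew : ∀ z, a z + a (-z) = if z = 0 then 2 else 0) :
    IsSignedConference (-1) fun u v => goethalsSeidel a b c d u v - if u = v then 1 else 0 := by
  have hs (u v : Fin 4 × G) : goethalsSeidel a b c d v u =
      (if u = v then 2 else 0) - goethalsSeidel a b c d u v := by
    obtain ⟨i, x⟩ := u
    obtain ⟨k, y⟩ := v
    have h1 := hskew (y - x)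
    simp only [neg_sub, sub_eq_zero (a := y), eq_comm (a := y)] at h1
    fin_cases i <;> fin_cases k <;>
    simp [goethalsSeidel, ← h1, ← neg_add', add_comm y x]
  refine ⟨fun i => ?_, fun i j hij => ?_, fun i j => ?_, fun i k => ?_⟩
  · have := hs i i
    simp at this ⊢
    omega
  · simpa [hij] using goethalsSeidel_sign ha hb hc hd i j
  · rw [hs i j]
    by_cases h : i = j
    · simp [h]
      ring
    · simp [h, Ne.symm h]
  · have h1 := goethalsSeidel_orth h i k
    have h2 := hs k i
    simp only [sub_mul, mul_sub, Finset.sum_sub_distrib, h1, mul_ite, ite_mul, mul_one,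
      one_mul, mul_zero, zero_mul, Finset.sum_ite_eq, Finset.mem_univ, if_true, h2,
      Fintype.card_prod, Fintype.card_fin]
    by_cases h : i = k
    · simp [h]
      ring
    · simp [h, Ne.symm h]

end

/-- The sum of `f o, …, f (o + 2 ^ l - 1)`, computed by binary splitting. -/
def treeSum (f : ℕ → ℕ) : ℕ → ℕ → ℕ
  | 0, o => f o
  | l + 1, o => treeSum f l o + treeSum f l (o + 2 ^ l)

theorem treeSum_eq (f : ℕ → ℕ) (l o : ℕ) :
    treeSum f l o = ∑ i ∈ Finset.range (2 ^ l), f (o + i) := by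
  induction l generalizing o with
  | zero => simp [treeSum]
  | succ l ih =>
    rw [treeSum, ih, ih, pow_succ, mul_two, Finset.sum_range_add]
    simp [add_assoc]

/-- The sum of `f` over `range n`, for `n ≤ 2 ^ l`. -/
def rangeSum (l n : ℕ) (f : ℕ → ℕ) : ℕ := treeSum (fun i => if i < n then f i else 0) l 0

theorem rangeSum_eq {l n : ℕ} (h : n ≤ 2 ^ l) (f : ℕ → ℕ) :
    rangeSum l n f = ∑ i ∈ Finset.range n, f i := by
  rw [rangeSum, treeSum_eq]
  simp only [zero_add]
  rw [← Finset.sum_filter]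
  congr 1
  ext i
  simp
  omega

theorem ZMod.sum_val {M : Type} [AddCommMonoid M] (n : ℕ) [NeZero n] (f : ℕ → M) :
    ∑ z : ZMod n, f z.val = ∑ i ∈ Finset.range n, f i := by
  obtain ⟨k, rfl⟩ := Nat.exists_eq_succ_of_ne_zero (NeZero.ne n)
  exact Fin.sum_univ_eq_sum_range f (k + 1)

theorem eq_of_sum_mul_pow_eq {B : ℕ} {n : ℕ} {f g : ℕ → ℕ} (hf : ∀ i < n, f i < B)
    (hg : ∀ i < n, g i < B)
    (h : ∑ i ∈ Finset.range n, f i * B ^ i = ∑ i ∈ Finset.range n, g i * B ^ i) :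
    ∀ i < n, f i = g i := by
  induction n generalizing f g with
  | zero => simp
  | succ n ih =>
    have hs (f : ℕ → ℕ) : ∑ i ∈ Finset.range (n + 1), f i * B ^ i =
        f 0 + B * ∑ i ∈ Finset.range n, f (i + 1) * B ^ i := by
      rw [Finset.sum_range_succ', Finset.mul_sum, add_comm]
      simp only [pow_zero, mul_one]
      congr 1
      exact Finset.sum_congr rfl fun i _ => by ring
    rw [hs, hs] at h
    have h0 : f 0 = g 0 := by
      have := congrArg (· % B) h
      simpa [Nat.mod_eq_of_lt, hf, hg] using this
    have hB : 0 < B := (hf 0 (by omega)).trans_le' (Nat.zero_le _)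
    rw [h0] at h
    have h1 := Nat.eq_of_mul_eq_mul_left hB (Nat.add_left_cancel h)
    rintro (_ | i) hi
    · exact h0
    · exact ih (f := fun i => f (i + 1)) (g := fun i => g (i + 1)) (fun i hi => hf _ (by omega))
        (fun i hi => hg _ (by omega)) h1 i (by omega)

theorem sum_mul_pow_lt {B : ℕ} {n : ℕ} {f : ℕ → ℕ} (hn : 0 < n) (hB : 0 < B)
    (hf : ∀ i < n, f i + 2 ≤ B) : ∑ i ∈ Finset.range n, f i * B ^ i < B ^ n - 1 := by
  have h : ∀ n, (∀ i < n, f i + 2 ≤ B) →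
      ∑ i ∈ Finset.range n, f i * B ^ i + ∑ i ∈ Finset.range n, B ^ i + 1 ≤ B ^ n := by
    intro n
    induction n with
    | zero => simp
    | succ n ih =>
      intro h
      have h1 := ih fun i hi => h i (by omega)
      have h2 := Nat.mul_le_mul_right (B ^ n) (h n (by omega))
      rw [Finset.sum_range_succ, Finset.sum_range_succ, pow_succ']
      have : 0 < B ^ n := by positivity
      linarith
  have h1 := h n hf
  have h2 : 0 < ∑ i ∈ Finset.range n, B ^ i :=
    Finset.sum_pos (fun i _ => by positivity) (by simpa using hn.ne')
  omega

theorem sum_mul_sum_neg_modEq {n : ℕ} [NeZero n] {B : ℕ} (hB : 0 < B) (g : ZMod n → ℕ) :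
    (∑ z, g z * B ^ z.val) * (∑ z, g z * B ^ (-z).val) ≡
      ∑ d : ZMod n, (∑ z, g z * g (z + d)) * B ^ d.val [MOD B ^ n - 1] := by
  rw [← ZMod.natCast_eq_natCast_iff]
  set b : ZMod (B ^ n - 1) := (B : ZMod (B ^ n - 1)) with hb
  have hbn : b ^ n = 1 := by
    have h0 : ((B ^ n - 1 : ℕ) : ZMod (B ^ n - 1)) = 0 := ZMod.natCast_self _
    rw [Nat.cast_sub (Nat.one_le_pow _ _ hB)] at h0
    push_cast at h0
    exact sub_eq_zero.1 h0
  have hadd (z w : ZMod n) : b ^ (z + w).val = b ^ z.val * b ^ w.val := by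
    rw [ZMod.val_add, ← pow_eq_pow_mod _ hbn, pow_add]
  push_cast
  rw [← hb, mul_comm, Finset.sum_mul_sum]
  simp only [Finset.sum_mul]
  rw [Finset.sum_comm (f := fun d z => (g z * g (z + d) : ZMod (B ^ n - 1)) * b ^ d.val)]
  refine Finset.sum_congr rfl fun z _ => ?_
  rw [← Equiv.sum_comp (Equiv.addLeft z)]
  refine Finset.sum_congr rfl fun d _ => ?_
  have : b ^ d.val = b ^ (-z).val * b ^ (z + d).val := by
    rw [← hadd, neg_add_cancel_left]
  rw [Equiv.coe_addLeft, this]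
  ring

/-- A certificate, by Kronecker substitution at `B`, for the periodic autocorrelations of the
sequences `f t - 1` on `ZMod n` to add up to `e` at `0` and to `0` elsewhere. -/
theorem sum_autocorrelation {T : Type} [Fintype T] {n : ℕ} [NeZero n] (f : T → ℕ → ℕ)
    (hf : ∀ t i, f t i ≤ 2) {l B c e : ℕ} (hl : n ≤ 2 ^ l)
    (hB : Fintype.card T * (n * 4) + 2 ≤ B) (hc : c + e + 2 ≤ B)
    (hs : c + Fintype.card T * n = 2 * ∑ t, rangeSum l n (f t))
    (h : (∑ t, rangeSum l n (fun i => f t i * B ^ i) *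
      rangeSum l n (fun i => f t i * B ^ ((n - i) % n))) % (B ^ n - 1) =
        c * ((B ^ n - 1) / (B - 1)) + e) (d : ZMod n) :
    ∑ t, ∑ z : ZMod n, ((f t z.val : ℤ) - 1) * ((f t (z + d).val : ℤ) - 1) =
      if d = 0 then (e : ℤ) else 0 := by
  have hn : 0 < n := Nat.pos_of_ne_zero (NeZero.ne n)
  let N (i : ℕ) : ℕ := ∑ t, ∑ z : ZMod n, f t z.val * f t (z + (i : ZMod n)).val
  let N' (i : ℕ) : ℕ := c + if i = 0 then e else 0
  have hN (i : ℕ) : N i + 2 ≤ B := by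
    refine le_trans (Nat.add_le_add_right ?_ 2) hB
    calc N i ≤ ∑ t : T, ∑ z : ZMod n, 4 := by
          refine Finset.sum_le_sum fun t _ => Finset.sum_le_sum fun z _ => ?_
          exact Nat.mul_le_mul (hf _ _) (hf _ _)
      _ = _ := by simp [ZMod.card]
  have hN' (i : ℕ) : N' i + 2 ≤ B := by
    simp only [N']
    split_ifs <;> omega
  have hsum' : ∑ i ∈ Finset.range n, N' i * B ^ i = c * ((B ^ n - 1) / (B - 1)) + e := by
    rw [← Nat.geomSum_eq (by omega)]
    simp only [N', add_mul, Finset.sum_add_distrib, ← Finset.mul_sum]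
    simp [hn]
  have hsum : ∑ i ∈ Finset.range n, N i * B ^ i = c * ((B ^ n - 1) / (B - 1)) + e := by
    have h1 := sum_mul_pow_lt hn (by omega) fun i _ => hN i
    rw [← h, ← Nat.mod_eq_of_lt h1, ← ZMod.sum_val]
    simp only [N, ZMod.natCast_val, ZMod.cast_id', id, Finset.sum_mul (s := (Finset.univ : Finset T))]
    rw [Finset.sum_comm]
    symm
    refine Nat.ModEq.sum fun t _ => ?_
    have := sum_mul_sum_neg_modEq (n := n) (B := B) (by omega) fun z => f t z.val
    simp only [ZMod.neg_val'] at this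
    rwa [ZMod.sum_val n fun i => f t i * B ^ i,
      ZMod.sum_val n fun i => f t i * B ^ ((n - i) % n), ← rangeSum_eq hl, ← rangeSum_eq hl] at this
  have key := eq_of_sum_mul_pow_eq (fun i _ => by have := hN i; omega)
    (fun i _ => by have := hN' i; omega) (hsum.trans hsum'.symm) d.val (ZMod.val_lt d)
  simp only [N, N', ZMod.natCast_val, ZMod.cast_id', id, ZMod.val_eq_zero] at key
  have key' : ∑ t, ∑ z : ZMod n, (f t z.val : ℤ) * f t (z + d).val =
      c + if d = 0 then (e : ℤ) else 0 := by
    exact_mod_cast key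
  have hs' : (c : ℤ) + Fintype.card T * n = 2 * ∑ t, ∑ z : ZMod n, (f t z.val : ℤ) := by
    have (t : T) : ∑ z : ZMod n, f t z.val = rangeSum l n (f t) := by
      rw [rangeSum_eq hl, ZMod.sum_val]
    exact_mod_cast hs.trans (by simp only [this])
  have hshift (t : T) : ∑ z : ZMod n, (f t (z + d).val : ℤ) = ∑ z : ZMod n, (f t z.val : ℤ) :=
    Equiv.sum_comp (Equiv.addRight d) fun z : ZMod n => (f t z.val : ℤ)
  simp only [sub_mul, mul_sub, one_mul, mul_one, Finset.sum_sub_distrib, hshift, key',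
    Finset.sum_const, Finset.card_univ, ZMod.card, nsmul_eq_mul]
  linear_combination hs'

/-- Twice the `i`-th binary digit of `m`. -/
def twiceBit (m i : ℕ) : ℕ := 2 * ((m >>> i) % 2)

theorem twiceBit_eq (m i : ℕ) : twiceBit m i = 0 ∨ twiceBit m i = 2 := by
  unfold twiceBit
  omega

theorem twiceBit_le (m i : ℕ) : twiceBit m i ≤ 2 := by
  rcases twiceBit_eq m i with h | h <;> omega

/-- The `±1` sequence on `ZMod n` whose signs are the binary digits of `m`. -/
def signSeq (n m : ℕ) (z : ZMod n) : ℤ := (twiceBit m z.val : ℤ) - 1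

theorem signSeq_sign (n m : ℕ) (z : ZMod n) : signSeq n m z = 1 ∨ signSeq n m z = -1 := by
  rcases twiceBit_eq m z.val with h | h <;> simp [signSeq, h]

section

variable {n : ℕ} [NeZero n] {m : Fin 4 → ℕ} {l B c : ℕ}

theorem signSeq_autocorrelation (hl : n ≤ 2 ^ l) (hB : 4 * (n * 4) + 2 ≤ B)
    (hc : c + 4 * n + 2 ≤ B) (hs : c + 4 * n = 2 * ∑ t, rangeSum l n (twiceBit (m t)))
    (h : (∑ t, rangeSum l n (fun i => twiceBit (m t) i * B ^ i) *
      rangeSum l n (fun i => twiceBit (m t) i * B ^ ((n - i) % n))) % (B ^ n - 1) =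
        c * ((B ^ n - 1) / (B - 1)) + 4 * n) (s : ZMod n) :
    ∑ z, signSeq n (m 0) z * signSeq n (m 0) (z + s) +
      ∑ z, signSeq n (m 1) z * signSeq n (m 1) (z + s) +
      ∑ z, signSeq n (m 2) z * signSeq n (m 2) (z + s) +
      ∑ z, signSeq n (m 3) z * signSeq n (m 3) (z + s) =
      if s = 0 then 4 * (Fintype.card (ZMod n) : ℤ) else 0 := by
  have := sum_autocorrelation (fun t => twiceBit (m t)) (fun t => twiceBit_le (m t)) hl
    (by simpa using hB) hc (by simpa using hs) h s
  rw [Fin.sum_univ_four] at this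
  rw [ZMod.card]
  exact_mod_cast this

theorem hasHadamard_of_signSeq (n l B c : ℕ) (m : Fin 4 → ℕ) [NeZero n]
    (hl : n ≤ 2 ^ l) (hB : 4 * (n * 4) + 2 ≤ B)
    (hc : c + 4 * n + 2 ≤ B) (hs : c + 4 * n = 2 * ∑ t, rangeSum l n (twiceBit (m t)))
    (h : (∑ t, rangeSum l n (fun i => twiceBit (m t) i * B ^ i) *
      rangeSum l n (fun i => twiceBit (m t) i * B ^ ((n - i) % n))) % (B ^ n - 1) =
        c * ((B ^ n - 1) / (B - 1)) + 4 * n) : HasHadamard (4 * n) := by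
  have hA := signSeq_autocorrelation hl hB hc hs h
  refine hasHadamard_of_rows (ι := Fin 4 × ZMod n) (κ := Fin 4 × ZMod n) (by simp [ZMod.card])
    (by simp [ZMod.card]) (goethalsSeidel (signSeq n (m 0)) (signSeq n (m 1)) (signSeq n (m 2))
      (signSeq n (m 3))) (goethalsSeidel_sign (signSeq_sign _ _) (signSeq_sign _ _)
      (signSeq_sign _ _) (signSeq_sign _ _)) fun u v => ?_
  rw [goethalsSeidel_orth hA, ZMod.card]
  push_cast
  rfl

theorem hasSkewConference_of_signSeq (n l B c : ℕ) (m : Fin 4 → ℕ) [NeZero n]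
    (hl : n ≤ 2 ^ l) (hB : 4 * (n * 4) + 2 ≤ B)
    (hc : c + 4 * n + 2 ≤ B) (hs : c + 4 * n = 2 * ∑ t, rangeSum l n (twiceBit (m t)))
    (h : (∑ t, rangeSum l n (fun i => twiceBit (m t) i * B ^ i) *
      rangeSum l n (fun i => twiceBit (m t) i * B ^ ((n - i) % n))) % (B ^ n - 1) =
        c * ((B ^ n - 1) / (B - 1)) + 4 * n)
    (hskew : ∀ i < n, twiceBit (m 0) i + twiceBit (m 0) ((n - i) % n) = if i = 0 then 4 else 2) :
    HasSkewConference (4 * n) := by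
  have hA := signSeq_autocorrelation hl hB hc hs h
  refine (isSignedConference_goethalsSeidel hA
    (signSeq_sign _ _) (signSeq_sign _ _) (signSeq_sign _ _) (signSeq_sign _ _)
    fun z => ?_).hasSkewConference (by simp [ZMod.card])
  have := hskew z.val (ZMod.val_lt z)
  simp only [ZMod.val_eq_zero] at this
  rw [signSeq, signSeq, ZMod.neg_val']
  split_ifs at this ⊢ <;> omega

end

theorem hasSkewConference_268 : HasSkewConference 268 :=
  hasSkewConference_of_signSeq 67 7 2048 272
    ![144972186828808225345,
      142689740472306647959,
      26070452838474550571,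
      112467284981637593696]
    (by norm_num) (by norm_num) (by norm_num) (by decide +kernel) (by decide +kernel)
    (by decide +kernel)

theorem hasSkewConference_412 : HasSkewConference 412 :=
  hasSkewConference_of_signSeq 103 7 2048 364
    ![6109820121985232203407026571085,
      3166039771973428198037809237629,
      1561127416256174094418005317180,
      2754341008448366354265342053632]
    (by norm_num) (by norm_num) (by norm_num) (by decide +kernel) (by decide +kernel)
    (by decide +kernel)

theorem hasSkewConference_532 : HasSkewConference 532 :=
  hasSkewConference_of_signSeq 133 8 4096 580
    ![378514659855088456264572095431214838239,
      6418117652922662223762844377026694205011,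
      9146029606147299214361088980887507629224,
      6731824551333323054281400356767292978526]
    (by norm_num) (by norm_num) (by norm_num) (by decide +kernel) (by decide +kernel)
    (by decide +kernel)

theorem hasSkewConference_652 : HasSkewConference 652 :=
  hasSkewConference_of_signSeq 163 8 4096 728
    ![4699089519203252134136064222238123615184808997171,
      8943803984718165432784323775115905528466046259777,
      11310502808255948029986490469137817740568590441818,
      5114495400790336952952205531054186205444262581073]
    (by norm_num) (by norm_num) (by norm_num) (by decide +kernel) (by decide +kernel)
    (by decide +kernel)

theorem hasHadamard_8236 : HasHadamard 8236 :=
  hasHadamard_of_signSeq 2059 12 65536 8244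
    ![51396028070144523747997333814783175519944087248778987929629012898104201161954944943423539139742405274194222691606333639339773810803546325730527710113815981891263267795078253546286355955055524429832971978895847373840763470229428011892548848561900969451174099444117125773087499889133062953435818697824442385205552501325872161330415317774627585992454819605099310696930819251809027473583066311599293117367943667385317822902533886191872703401728796708964247643472341258385971106397872743003050610995846041259009322569443243841032661804958743581072182946974563991656892960785617298977840128725783564215865417553128161594852007,
      45005300671907318985020132955615122334659722481144915586545067021187701045687572800632395584170713361873849841622074234840393977362308077893483346203946602512747680975390842899966173295680489685612041431954190093178511683370175173081510419998245966035499314147483538386800371417762397537685375801806617169468201427010262953121958104527163108585708359517760498279586614728092512869440651968339165124436233758191424883627263124424622352048070289697648327548615027926624094591234414724235605511635176387755840330532259003666975750727271701299245587701857105052733051301680040060094954373138879505081544348343191543192855832,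
      45610944783981693427874190471166979832858903718638425968080343535025429429991432030985822645074078395401004594621277750444421179027073992982950306470326060634929650788140499313301646118914831580367114256121374182828837345071186024868188407358973494108311646778484383700003677560501688108726807214028805449175395117133902554222010642070547588902022984627816453099522356832316555627985942590729607784031614483912738633794279860843077140501173395372241220008454664805398802867776015274354376233832345516761526275914707076353890881518441663684395464545047568407611547963920600136641434605863539270846576758768296787943864197,
      10160151988089275446893033415362379829067434360458293467195620693093420128183212991554467942193917863875105804189092470341977982798315998837234820861957480842769506912778712213353145636439312960831439494428313749296600646528415090901930825668549321489520768569002465104078612142874267281523257271796517318556432891989612782004215716354939867657767417545508360870249606204404729261787253629993880121933679841587763276157342755606242832664205779760672035230754356872415573816251824125946537641941767362459987049192772889546226383276252384810880488339104710440108709419600266179748797174054307493864897013766530660110544836]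
    (by norm_num) (by norm_num) (by norm_num) (by decide +kernel) (by decide +kernel)

section

variable {F : Type} [Field F] [Fintype F]

/-- The linear form `z ↦ z.2 + s * z.1` on the plane, or `z ↦ z.1` for the point at infinity. -/
def linearForm (o : Option F) (z : F × F) : F := o.elim z.1 fun s => z.2 + s * z.1

theorem sum_linearForm (o : Option F) (g : F → ℤ) :
    ∑ z, g (linearForm o z) = Fintype.card F * ∑ t, g t := by
  rw [Fintype.sum_prod_type]
  rcases o with _ | s
  · simp [linearForm, Finset.mul_sum]
  · have (a : F) : ∑ b, g (b + s * a) = ∑ b, g b := Equiv.sum_comp (Equiv.addRight (s * a)) g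
    simp [linearForm, this]

theorem sum_linearForm_mul {o o' : Option F} (ho : o ≠ o') (g h : F → ℤ) :
    ∑ z, g (linearForm o z) * h (linearForm o' z) = (∑ t, g t) * ∑ t, h t := by
  have hinj : Function.Injective fun z : F × F => (linearForm o z, linearForm o' z) := by
    rintro ⟨a, b⟩ ⟨a', b'⟩ hz
    simp only [Prod.mk.injEq] at hz ⊢
    obtain ⟨h1, h2⟩ := hz
    rcases o with _ | s <;> rcases o' with _ | s' <;> simp [linearForm] at h1 h2 ho
    · subst h1
      exact ⟨rfl, by simpa using h2⟩
    · subst h2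
      exact ⟨rfl, by simpa using h1⟩
    · have h3 : (s - s') * (a - a') = 0 := by linear_combination h1 - h2
      have h4 := sub_eq_zero.1 ((mul_eq_zero.1 h3).resolve_left (sub_ne_zero.2 ho))
      subst h4
      exact ⟨rfl, by simpa using h1⟩
  rw [Finset.sum_mul_sum, ← Fintype.sum_prod_type']
  exact (Finite.injective_iff_bijective.1 hinj).sum_comp fun z => g z.1 * h z.2

theorem sum_linearForm_eq [DecidableEq F] (x y : F × F) :
    ∑ o, (if linearForm o x = linearForm o y then (1 : ℤ) else 0) =
      if x = y then (Fintype.card F : ℤ) + 1 else 1 := by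
  obtain ⟨a, b⟩ := x
  obtain ⟨a', b'⟩ := y
  rw [Fintype.sum_option]
  simp only [linearForm, Option.elim_none, Option.elim_some, Prod.mk.injEq]
  by_cases h : a = a'
  · subst h
    by_cases hb : b = b'
    · simp [hb]
      ring
    · simp [hb]
  · have hs (s : F) : b + s * a = b' + s * a' ↔ s = (b' - b) / (a - a') := by
      rw [eq_div_iff (sub_ne_zero.2 h)]
      constructor <;> intro h <;> linear_combination h
    simp [h, hs]

end

section

variable {F K : Type} [Fintype F] [DecidableEq F] [Fintype K] [DecidableEq K]

/-- The entry of Mathon's conference matrix core in row `u` and column `v`. -/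
def mathonEntry (σ ε : K → K → ℤ) (Q : F → F → ℤ) (φ : K → K → F × F → F)
    (u v : K × (F × F)) : ℤ :=
  (if u.1 = v.1 then ∑ k, ε u.1 k * (if φ u.1 k u.2 = φ u.1 k v.2 then 1 else 0) else 0) +
    σ u.1 v.1 * (ε u.1 v.1 * Q (φ u.1 v.1 u.2) (φ v.1 u.1 v.2) +
      if φ u.1 v.1 u.2 = φ v.1 u.1 v.2 then 1 else 0)

theorem isCore_mathonEntry {σ ε : K → K → ℤ} {Q : F → F → ℤ} {φ : K → K → F × F → F}
    (hcard : Fintype.card K = Fintype.card F + 2) (hσ : IsCore 1 σ) (hQ : IsCore (-1) Q)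
    (hε0 : ∀ i, ε i i = 0) (hε1 : ∀ i j, i ≠ j → ε i j = 1 ∨ ε i j = -1)
    (hεs : ∀ i j, ε j i = -ε i j) (hεr : ∀ i, ∑ j, ε i j = 0)
    (h1 : ∀ i j (g : F → ℤ), ∑ z, g (φ i j z) = Fintype.card F * ∑ t, g t)
    (h2 : ∀ i j k, i ≠ j → i ≠ k → j ≠ k → ∀ g h : F → ℤ,
      ∑ z, g (φ i j z) * h (φ i k z) = (∑ t, g t) * ∑ t, h t)
    (h3 : ∀ i x y, ∑ k, (if k = i then 0 else if φ i k x = φ i k y then (1 : ℤ) else 0) =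
      if x = y then (Fintype.card F : ℤ) + 1 else 1) :
    IsCore 1 (mathonEntry σ ε Q φ) := by
  set q : ℤ := (Fintype.card F : ℤ) with hq
  let M (i j : K) (u v : F) : ℤ := ε i j * Q u v + if u = v then 1 else 0
  let D (i : K) (x y : F × F) : ℤ := ∑ k, ε i k * (if φ i k x = φ i k y then 1 else 0)
  have hS (i j : K) (x y : F × F) : mathonEntry σ ε Q φ (i, x) (j, y) =
      (if i = j then D i x y else 0) + σ i j * M i j (φ i j x) (φ j i y) := rfl
  have hεsq (i k : K) : ε i k * ε i k = if k = i then 0 else 1 := by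
    split_ifs with h
    · simp [h, hε0]
    · rcases hε1 i k (Ne.symm h) with h | h <;> simp [h]
  have hσsq (i k : K) : σ i k * σ i k = if k = i then 0 else 1 := by
    split_ifs with h
    · simp [h, hσ.diag]
    · rcases hσ.off i k (Ne.symm h) with h | h <;> simp [h]
  have hMs (i j : K) (u v : F) : M j i v u = M i j u v := by
    simp only [M, hεs i j, hQ.symm u v, eq_comm (a := v)]
    ring
  have hMr (i j : K) (u : F) : ∑ t, M i j u t = 1 := by
    simp [M, Finset.sum_add_distrib, ← Finset.mul_sum, hQ.row]
  have hMM (i j : K) (hij : i ≠ j) (u v : F) :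
      ∑ t, M i j u t * M i j v t = (q + 1) * (if u = v then 1 else 0) - 1 := by
    have e1 : ∀ t, M i j u t * M i j v t = (ε i j * ε i j) * (Q u t * Q v t) +
        ε i j * (Q u t * if v = t then 1 else 0) + ε i j * (Q v t * if u = t then 1 else 0) +
        (if u = t then 1 else 0) * (if v = t then 1 else 0) := fun t => by
      simp only [M]
      ring
    simp only [e1, Finset.sum_add_distrib, ← Finset.mul_sum, hεsq, hQ.orth, if_neg hij.symm]
    simp only [mul_ite, mul_one, mul_zero, Finset.sum_ite_eq, Finset.mem_univ, if_true,
      hQ.symm u v]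
    by_cases h : u = v
    · simp [h, hQ.diag]
      ring
    · simp [h]
  have hDM (i i' : K) (hi : i ≠ i') (x : F × F) (u' : F) :
      ∑ y, D i x y * M i' i u' (φ i i' y) = ε i i' * (q * M i' i u' (φ i i' x) - 1) := by
    simp only [D, Finset.sum_mul]
    rw [Finset.sum_comm]
    have e1 (k : K) : ∑ y, ε i k * (if φ i k x = φ i k y then 1 else 0) * M i' i u' (φ i i' y) =
        ε i k + if k = i' then ε i i' * (q * M i' i u' (φ i i' x) - 1) else 0 := by
      simp only [mul_assoc, ← Finset.mul_sum]
      by_cases hk : k = i'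
      · subst hk
        rw [h1 i k fun t => (if φ i k x = t then 1 else 0) * M k i u' t]
        simp
        ring
      · by_cases hki : i = k
        · simp [← hki, hε0, hi]
        · rw [h2 i k i' hki hi hk (fun t => if φ i k x = t then 1 else 0) (M i' i u'), hMr]
          simp [hk]
    simp only [e1, Finset.sum_add_distrib, hεr, Finset.sum_ite_eq', Finset.mem_univ, if_true,
      zero_add]
  have hDD (i : K) (x x' : F × F) : ∑ y, D i x y * D i x' y =
      (if x = x' then q * q + q else q) - (q + 1) := by
    simp only [D, Finset.sum_mul_sum]
    rw [Finset.sum_comm]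
    have e1 (k : K) : ∑ y, ∑ l, ε i k * (if φ i k x = φ i k y then 1 else 0) *
        (ε i l * if φ i l x' = φ i l y then 1 else 0) =
        q * (if k = i then 0 else if φ i k x = φ i k x' then 1 else 0) -
          (if k = i then 0 else 1) := by
      rw [Finset.sum_comm]
      have e2 (l : K) : ∑ y, ε i k * (if φ i k x = φ i k y then 1 else 0) *
          (ε i l * if φ i l x' = φ i l y then 1 else 0) = ε i k * ε i l +
          if l = k then ε i k * ε i k * (q * (if φ i k x = φ i k x' then 1 else 0) - 1) else 0 := by
        have e3 : ∑ y, ε i k * (if φ i k x = φ i k y then 1 else 0) *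
            (ε i l * if φ i l x' = φ i l y then 1 else 0) = ε i k * ε i l *
            ∑ y, (if φ i k x = φ i k y then 1 else 0) * if φ i l x' = φ i l y then 1 else 0 := by
          rw [Finset.mul_sum]
          exact Finset.sum_congr rfl fun y _ => by ring
        rw [e3]
        by_cases hl : l = k
        · subst hl
          rw [h1 i l fun t => (if φ i l x = t then 1 else 0) * (if φ i l x' = t then 1 else 0)]
          simp only [mul_ite, mul_one, mul_zero, Finset.sum_ite_eq, Finset.mem_univ, if_true]
          by_cases hx : φ i l x = φ i l x'
          · simp [hx]
            ring
          · simp [hx]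
        · by_cases hk : i = k
          · simp [← hk, hε0]
          by_cases hl' : i = l
          · simp [← hl', hε0, hk]
          · rw [h2 i k l hk hl' (Ne.symm hl) (fun t => if φ i k x = t then 1 else 0)
              (fun t => if φ i l x' = t then 1 else 0)]
            simp [hl]
      simp only [e2, Finset.sum_add_distrib, ← Finset.mul_sum, hεr, hεsq]
      simp
      split_ifs <;> simp
    simp only [e1]
    simp only [Finset.sum_sub_distrib, ← Finset.mul_sum, h3]
    have e3 : ∑ k : K, (if k = i then (0 : ℤ) else 1) = q + 1 := by
      have : ∀ k : K, (if k = i then (0 : ℤ) else 1) = 1 - if k = i then 1 else 0 := fun k => by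
        split_ifs <;> rfl
      simp only [this, Finset.sum_sub_distrib]
      simp [hcard]
      ring
    rw [e3]
    split_ifs <;> ring
  refine ⟨?_, ?_, ?_, ?_, ?_⟩
  · rintro ⟨i, x⟩
    simp [hS, hσ.diag, D, hεr]
  · rintro ⟨i, x⟩ ⟨j, y⟩ hne
    rw [hS]
    by_cases hij : i = j
    · subst hij
      have hxy : x ≠ y := by simpa using hne
      have h4 := h3 i x y
      rw [if_neg hxy] at h4
      have hc : (Finset.univ.filter fun k => k ≠ i ∧ φ i k x = φ i k y).card = 1 := by
        rw [Finset.card_filter]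
        zify
        refine Eq.trans (Finset.sum_congr rfl fun k _ => ?_) h4
        by_cases hk : k = i <;> simp [hk]
      obtain ⟨k, hk⟩ := Finset.card_eq_one.1 hc
      have hk1 : k ∈ Finset.univ.filter fun k => k ≠ i ∧ φ i k x = φ i k y := by simp [hk]
      have hD : D i x y = ε i k := by
        rw [← Finset.sum_singleton (ε i) k, ← hk, Finset.sum_filter]
        refine Finset.sum_congr rfl fun l _ => ?_
        by_cases hl : l = i <;> simp [hl, hε0]
      simp only [if_true, hD, hσ.diag, zero_mul, add_zero]
      exact hε1 i k (by simpa using (Ne.symm (Finset.mem_filter.1 hk1).2.1))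
    · simp only [if_neg hij, zero_add, M]
      rcases hσ.off i j hij with h | h <;> rcases hε1 i j hij with h' | h' <;>
      by_cases hu : φ i j x = φ j i y
      all_goals first
        | simp [h, h', hu, hQ.diag]; done
        | rcases hQ.off _ _ hu with h'' | h'' <;> simp [h, h', hu, h'']
  · rintro ⟨i, x⟩ ⟨j, y⟩
    simp only [hS, hMs i j, hσ.symm i j, one_mul]
    by_cases h : i = j
    · subst h
      simp only [if_true, D, eq_comm (a := φ i _ y)]
    · simp [h, Ne.symm h]
  · rintro ⟨i, x⟩
    rw [Fintype.sum_prod_type]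
    have e1 (j : K) : ∑ y, σ i j * M i j (φ i j x) (φ j i y) = q * σ i j := by
      rw [← Finset.mul_sum, h1 j i, hMr]
      ring
    have e2 : ∑ y, D i x y = 0 := by
      simp only [D]
      rw [Finset.sum_comm]
      have e3 (k : K) : ∑ y, ε i k * (if φ i k x = φ i k y then (1 : ℤ) else 0) = q * ε i k := by
        rw [← Finset.mul_sum, h1 i k fun t => if φ i k x = t then 1 else 0]
        simp
        ring
      simp only [e3, ← Finset.mul_sum, hεr, mul_zero]
    simp only [hS, Finset.sum_add_distrib, e1, ← Finset.mul_sum, hσ.row]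
    simp only [Finset.sum_ite_irrel, Finset.sum_const_zero, Finset.sum_ite_eq, Finset.mem_univ,
      if_true, e2]
    simp
  · rintro ⟨i, x⟩ ⟨i', x'⟩
    rw [Fintype.sum_prod_type]
    have e0 (j : K) : ∑ y, mathonEntry σ ε Q φ (i, x) (j, y) * mathonEntry σ ε Q φ (i', x') (j, y) =
        (if i = j then if i' = i then ∑ y, D i x y * D i x' y else 0 else 0) +
        (if i = j then σ i' i * ∑ y, D i x y * M i' i (φ i' i x') (φ i i' y) else 0) +
        (if i' = j then σ i i' * ∑ y, D i' x' y * M i i' (φ i i' x) (φ i' i y) else 0) +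
        σ i j * σ i' j * ∑ y, M i j (φ i j x) (φ j i y) * M i' j (φ i' j x') (φ j i' y) := by
      simp only [hS, Finset.mul_sum]
      by_cases hi : i = j
      · subst hi
        by_cases hi' : i' = i
        · subst hi'
          simp [hσ.diag]
        · simp [hi', hσ.diag]
          exact Finset.sum_congr rfl fun y _ => by ring
      · by_cases hi' : i' = j
        · subst hi'
          simp [hi, hσ.diag]
          exact Finset.sum_congr rfl fun y _ => by ring
        · simp [hi, hi']
          exact Finset.sum_congr rfl fun y _ => by ring
    simp only [e0, Finset.sum_add_distrib, Finset.sum_ite_eq, Finset.mem_univ, if_true]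
    have hc : (Fintype.card (K × (F × F)) : ℤ) = q * q * (q + 2) := by
      simp [hcard]
      ring
    by_cases hi : i = i'
    · subst hi
      have e1 (j : K) : σ i j * σ i j *
          ∑ y, M i j (φ i j x) (φ j i y) * M i j (φ i j x') (φ j i y) =
          q * (q + 1) * (if j = i then 0 else if φ i j x = φ i j x' then 1 else 0) -
            q * (σ i j * σ i j) := by
        rw [h1 j i fun t => M i j (φ i j x) t * M i j (φ i j x') t, hσsq]
        by_cases h : j = i
        · simp [h]
        · rw [hMM i j (Ne.symm h)]
          simp only [h, if_false]
          ring
      simp only [e1, Finset.sum_sub_distrib, ← Finset.mul_sum, h3, hσ.orth, hσ.diag, hDD, hc,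
        hcard, if_true, Prod.mk.injEq, true_and]
      push_cast
      split_ifs <;> ring
    · have e1 (j : K) : σ i j * σ i' j *
          ∑ y, M i j (φ i j x) (φ j i y) * M i' j (φ i' j x') (φ j i' y) = σ i j * σ i' j := by
        by_cases hj : j = i
        · simp [hj, hσ.diag]
        by_cases hj' : j = i'
        · simp [hj', hσ.diag]
        · rw [h2 j i i' hj hj' hi, hMr, hMr]
          ring
      simp only [e1, hσ.orth, hDM i i' hi, hDM i' i (Ne.symm hi),
        if_neg (Ne.symm hi), Prod.mk.injEq, hi, false_and, if_false]
      rw [hMs i i', hεs i i', hσ.symm i i']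
      ring

end

theorem exists_isCore_mathonEntry {F K : Type} [Field F] [Fintype F] [DecidableEq F] [Fintype K]
    [DecidableEq K] [AddCommGroup K] {σ ε : K → K → ℤ} {Q : F → F → ℤ}
    (hcard : Fintype.card K = Fintype.card F + 2) (hσ : IsCore 1 σ) (hQ : IsCore (-1) Q)
    (hε0 : ∀ i, ε i i = 0) (hε1 : ∀ i j, i ≠ j → ε i j = 1 ∨ ε i j = -1)
    (hεs : ∀ i j, ε j i = -ε i j) (hεr : ∀ i, ∑ j, ε i j = 0) :
    ∃ φ, IsCore 1 (mathonEntry σ ε Q φ) := by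
  have hc : Fintype.card {d : K // d ≠ 0} = Fintype.card (Option F) := by
    rw [Fintype.card_subtype_compl, Fintype.card_subtype_eq, Fintype.card_option]
    lia
  let e := Fintype.equivOfCardEq hc
  let f (d : K) : Option F := if h : d = 0 then none else e ⟨d, h⟩
  have hf (d : {d : K // d ≠ 0}) : f d = e d := by simp [f, d.2]
  refine ⟨fun i j => linearForm (f (j - i)), isCore_mathonEntry hcard hσ hQ hε0 hε1 hεs hεr
    (fun i j g => sum_linearForm _ g) (fun i j k hij hik hjk g h => sum_linearForm_mul ?_ g h)
    fun i x y => ?_⟩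
  · have h1 := hf ⟨j - i, sub_ne_zero.2 hij.symm⟩
    have h2 := hf ⟨k - i, sub_ne_zero.2 hik.symm⟩
    rw [h1, h2]
    simpa using hjk
  · rw [← sum_linearForm_eq x y, ← e.sum_comp, ← Equiv.sum_comp (Equiv.addRight i)]
    simp only [Equiv.coe_addRight, add_eq_right, add_sub_cancel_right, ← hf]
    rw [← Finset.sum_subtype (Finset.univ.filter fun d : K => d ≠ 0) (by simp)
      fun d => if linearForm (f d) x = linearForm (f d) y then (1 : ℤ) else 0, Finset.sum_filter]
    exact Finset.sum_congr rfl fun d _ => by by_cases h : d = 0 <;> simp [h]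

theorem exists_isCore_neg_one (p : ℕ) [Fact p.Prime] (h : ZMod.χ₄ p = -1) :
    ∃ Q : ZMod p → ZMod p → ℤ, IsCore (-1) Q := by
  have hp : p ≠ 2 := by
    rintro rfl
    exact absurd h (by decide)
  have := hasCore_of_prime Fact.out hp
  rw [h] at this
  exact this.exists_isCore _ (ZMod.card p)

theorem hasCore_1573 : HasCore 1 1573 := by
  have : Fact (Nat.Prime 11) := ⟨by norm_num⟩
  obtain ⟨Q, hQ⟩ := exists_isCore_neg_one 11 (by decide)
  obtain ⟨σ, hσ⟩ := HasCore.exists_isCore (hasCore_of_prime (p := 13) (by norm_num) (by norm_num))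
    (ZMod 13) (ZMod.card 13)
  rw [show ZMod.χ₄ (13 : ℕ) = 1 by decide] at hσ
  obtain ⟨φ, h⟩ := exists_isCore_mathonEntry (F := ZMod 11) (K := ZMod 13)
    (ε := fun i j => if i = j then 0 else if (j - i).val ≤ 6 then 1 else -1)
    (by simp [ZMod.card]) hσ hQ
    (by decide) (by decide) (by decide) (by decide)
  exact h.hasCore (by simp [ZMod.card])

theorem hasCore_441 : HasCore 1 441 := by
  have : Fact (Nat.Prime 7) := ⟨by norm_num⟩
  obtain ⟨Q, hQ⟩ := exists_isCore_neg_one 7 (by decide)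
  have hσ : IsCore 1 fun i j : ZMod 3 × ZMod 3 =>
      if i = j then (0 : ℤ) else if (i.1 - j.1) * (i.2 - j.2) = 0 then 1 else -1 := by
    constructor <;> decide
  obtain ⟨φ, h⟩ := exists_isCore_mathonEntry (F := ZMod 7)
    (ε := fun i j => if i = j then 0 else
      if j - i ∈ [((0 : ZMod 3), (1 : ZMod 3)), (1, 0), (1, 1), (1, 2)] then 1 else -1)
    (by simp [ZMod.card]) hσ hQ
    (by decide) (by decide) (by decide) (by decide)
  exact h.hasCore (by simp [ZMod.card])

/-- The Hadamard matrix of order four obtained by Sylvester's construction. -/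
def sylvesterFour (c d : Bool × Bool) : ℤ :=
  (if c.1 && d.1 then -1 else 1) * if c.2 && d.2 then -1 else 1

theorem sum_mul_comp_eq {L C : Type} [Fintype L] [Fintype C] [DecidableEq C] (p : L → C)
    (f : L → ℤ) (g : C → ℤ) :
    ∑ y, f y * g (p y) = ∑ c, g c * ∑ y, if p y = c then f y else 0 := by
  simp only [Finset.mul_sum]
  rw [Finset.sum_comm]
  refine Finset.sum_congr rfl fun y _ => ?_
  simp [mul_comm]

/-- Miyamoto's construction: a pair of matrices `U`, `V` with disjoint supports, whose rows and
columns are distributed into four classes, bordered to give a Hadamard matrix. -/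
theorem hasHadamard_of_bordered {K L : Type} [Fintype K] [DecidableEq K] [Fintype L] {h : ℕ}
    (hK : Fintype.card K = 4 * h) (hL : Fintype.card L = 4 * h)
    (p : K → Bool × Bool) (r : L → Bool × Bool) (s : Bool × Bool → ℤ) (U V : K → L → ℤ)
    (hr : ∀ c, ∑ y, (if r y = c then 1 else 0) = (h : ℤ)) (hs : ∀ c, s c = 1 ∨ s c = -1)
    (hUV : ∀ x y, U x y = 0 ∧ (V x y = 1 ∨ V x y = -1) ∨ V x y = 0 ∧ (U x y = 1 ∨ U x y = -1))
    (hUr : ∀ x c, ∑ y, (if r y = c then U x y else 0) = if p x = c then s c else 0)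
    (hUU : ∀ x x', ∑ y, U x y * U x' y =
      (if x = x' then 2 * (h : ℤ) + 1 else 0) - if p x = p x' then 2 else 0)
    (hVV : ∀ x x', ∑ y, V x y * V x' y = if x = x' then 2 * (h : ℤ) + 1 else 0) :
    HasHadamard (4 * (2 * h + 1)) := by
  let E (i j : Bool × Bool) : ℤ := if i = j then 1 else -1
  let R (i c : Bool × Bool) : ℤ := s c * if c = (false, false) then 1 else -sylvesterFour i c
  let σ (a : Bool) : ℤ := if a then -1 else 1
  let B (i : Bool × Bool) : (Bool × Bool) ⊕ (L × Bool) → ℤ :=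
    Sum.elim (E i) fun y => R i (r y.1)
  let W (x : K × Bool) : (Bool × Bool) ⊕ (L × Bool) → ℤ :=
    Sum.elim (sylvesterFour (p x.1)) fun y => U x.1 y.1 + σ x.2 * σ y.2 * V x.1 y.1
  have hss (c : Bool × Bool) : s c * s c = 1 := mul_self_eq_one_iff.2 (hs c)
  have hBB (i k : Bool × Bool) : ∑ z, B i z * B k z =
      if i = k then ((4 * (2 * h + 1) : ℕ) : ℤ) else 0 := by
    have e1 : ∑ y, R i (r y) * R k (r y) = ∑ c, R i c * R k c * h := by
      have := sum_mul_comp_eq r 1 fun c => R i c * R k c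
      simp only [Pi.one_apply, one_mul, hr] at this
      exact this
    have e2 (c : Bool × Bool) : R i c * R k c = (if c = (false, false) then 1 else
        -sylvesterFour i c) * if c = (false, false) then 1 else -sylvesterFour k c := by
      simp only [R]
      rw [mul_mul_mul_comm, hss, one_mul]
    simp only [B, Fintype.sum_sum_type, Fintype.sum_prod_type, Sum.elim_inl, Sum.elim_inr,
      Finset.sum_const, Finset.card_univ, Fintype.card_bool, ← Finset.smul_sum, e1]
    simp only [e2, ← Finset.sum_mul]
    have e3 : ∀ i k : Bool × Bool,
        (∑ a, ∑ b, E i (a, b) * E k (a, b) = if i = k then 4 else 0) ∧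
        (∑ a, ∑ b, (if (a, b) = (false, false) then (1 : ℤ) else -sylvesterFour i (a, b)) *
          if (a, b) = (false, false) then 1 else -sylvesterFour k (a, b)) =
        if i = k then 4 else 0 := by
      decide
    rw [(e3 i k).1, (e3 i k).2]
    split_ifs
    · push_cast
      ring
    · simp
  have hWB (x : K × Bool) (i : Bool × Bool) : ∑ z, W x z * B i z = 0 := by
    have e1 (y : L) : ∑ b, (U x.1 y + σ x.2 * σ b * V x.1 y) * R i (r y) =
        2 * (U x.1 y * R i (r y)) := by
      rw [Fintype.sum_bool, show σ true = -1 from rfl, show σ false = 1 from rfl]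
      ring
    have e2 : ∀ i k : Bool × Bool, ∑ a, ∑ b, sylvesterFour k (a, b) * E i (a, b) =
        -2 * if k = (false, false) then 1 else -sylvesterFour i k := by
      decide
    simp only [B, W, Fintype.sum_sum_type, Fintype.sum_prod_type, Sum.elim_inl, Sum.elim_inr, e1,
      ← Finset.mul_sum, sum_mul_comp_eq r (U x.1) (R i), hUr, mul_ite, mul_zero,
      Finset.sum_ite_eq, Finset.mem_univ, if_true]
    rw [e2]
    simp only [R]
    rw [mul_right_comm, hss]
    ring
  have hWW (x x' : K × Bool) : ∑ z, W x z * W x' z =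
      if x = x' then ((4 * (2 * h + 1) : ℕ) : ℤ) else 0 := by
    have e1 (y : L) : ∑ b, (U x.1 y + σ x.2 * σ b * V x.1 y) *
        (U x'.1 y + σ x'.2 * σ b * V x'.1 y) =
        2 * (U x.1 y * U x'.1 y) + 2 * (σ x.2 * σ x'.2) * (V x.1 y * V x'.1 y) := by
      rw [Fintype.sum_bool, show σ true = -1 from rfl, show σ false = 1 from rfl]
      ring
    have e2 : ∀ c d : Bool × Bool, ∑ a, ∑ b, sylvesterFour c (a, b) * sylvesterFour d (a, b) =
        if c = d then 4 else 0 := by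
      decide
    simp only [W, Fintype.sum_sum_type, Fintype.sum_prod_type, Sum.elim_inl, Sum.elim_inr, e1,
      Finset.sum_add_distrib, ← Finset.mul_sum, hUU, hVV, e2]
    obtain ⟨x, a⟩ := x
    obtain ⟨x', a'⟩ := x'
    by_cases hx : x = x'
    · subst hx
      cases a <;> cases a' <;> simp [σ] <;> ring
    · simp only [hx, Prod.mk.injEq, false_and, if_false]
      split_ifs <;> ring
  refine hasHadamard_of_rows (ι := (Bool × Bool) ⊕ (K × Bool)) (κ := (Bool × Bool) ⊕ (L × Bool))
    (by simp [hK]; ring) (by simp [hL]; ring) (Sum.elim B W) ?_ ?_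
  · have hC : ∀ c d, sylvesterFour c d = 1 ∨ sylvesterFour c d = -1 := by decide
    have hσ (a : Bool) : σ a = 1 ∨ σ a = -1 := by cases a <;> simp [σ]
    rintro (i | ⟨x, a⟩) (j | ⟨y, b⟩)
    · simp only [Sum.elim_inl, B, E]
      split_ifs <;> simp
    · simp only [Sum.elim_inl, Sum.elim_inr, B, R]
      rcases hs (r y) with h1 | h1 <;> rcases hC i (r y) with h2 | h2 <;> rw [h1, h2] <;>
      split_ifs <;> simp
    · exact hC _ _
    · simp only [Sum.elim_inr, W]
      rcases hσ a with h1 | h1 <;> rcases hσ b with h2 | h2 <;>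
      rcases hUV x y with ⟨h3, h4 | h4⟩ | ⟨h3, h4 | h4⟩ <;> simp [h1, h2, h3, h4]
  · rintro (i | x) (k | x')
    · simp [hBB]
    · simp only [Sum.elim_inl, Sum.elim_inr, mul_comm (B i _), hWB]
      simp
    · simp [hWB]
    · simp [hWW]

theorem HasCore.hasHadamard_four_mul {h : ℕ} (hS : HasCore 1 (2 * h + 1))
    (hH : HasHadamard (2 * h)) : HasHadamard (4 * (2 * h + 1)) := by
  obtain ⟨S, hS⟩ := hS.exists_isCore (Option (Fin (2 * h))) (by simp)
  obtain ⟨H, hH⟩ := hH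
  have hrow := hH.sum_row
  have hcol := hH.sum_col
  let u (y : Fin (2 * h)) : ℤ := S none (some y)
  let T (x y : Fin (2 * h)) : ℤ := S (some x) (some y)
  have hTd (x) : T x x = 0 := hS.diag _
  have hTo (x y) (hxy : x ≠ y) : T x y = 1 ∨ T x y = -1 := hS.off _ _ (by simpa using hxy)
  have hu (y) : u y = 1 ∨ u y = -1 := hS.off _ _ (by simp)
  have hu' (y) : S (some y) none = u y := by rw [hS.symm none (some y), one_mul]
  have hsu : ∑ y, u y = 0 := by
    have := hS.row none
    rw [Fintype.sum_option, hS.diag, zero_add] at this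
    exact this
  have hTr (x) : ∑ y, T x y = -u x := by
    have := hS.row (some x)
    rw [Fintype.sum_option, hu'] at this
    exact (neg_eq_of_add_eq_zero_right this).symm
  have hTu (x) : ∑ y, u y * T x y = -1 := by
    have := hS.orth none (some x)
    rw [Fintype.sum_option, hS.diag, zero_mul, zero_add] at this
    simpa using this
  have hTT (x x') : ∑ y, T x y * T x' y =
      (if x = x' then 2 * (h : ℤ) + 1 else 0) - 1 - u x * u x' := by
    have := hS.orth (some x) (some x')
    rw [Fintype.sum_option, hu', hu'] at this
    simp only [Option.some.injEq, Fintype.card_option, Fintype.card_fin, Nat.cast_add,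
      Nat.cast_mul, Nat.cast_one, Nat.cast_ofNat] at this
    linear_combination this
  let s (t : Bool) : ℤ := if t then -1 else 1
  have hind (t : Bool) (y) : 2 * (if decide (u y = 1) = t then 1 else 0) = 1 - s t * u y := by
    rcases hu y with h1 | h1 <;> cases t <;> simp [h1, s]
  have hcount (t : Bool) : ∑ y, (if decide (u y = 1) = t then 1 else 0) = (h : ℤ) := by
    refine mul_left_cancel₀ (two_ne_zero' ℤ) ?_
    rw [Finset.mul_sum]
    simp only [hind, Finset.sum_sub_distrib, ← Finset.mul_sum, hsu]
    simp
  have hsum (t : Bool) (x) : ∑ y, (if decide (u y = 1) = t then T x y else 0) =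
      if decide (u x = 1) = t then s t else 0 := by
    have h1 (y) : 2 * (if decide (u y = 1) = t then T x y else 0) =
        T x y - s t * (u y * T x y) := by
      have := hind t y
      split_ifs at this ⊢ <;> linear_combination T x y * this
    refine mul_left_cancel₀ (two_ne_zero' ℤ) ?_
    rw [Finset.mul_sum]
    simp only [h1, Finset.sum_sub_distrib, ← Finset.mul_sum, hTr, hTu]
    rcases hu x with hx | hx <;> cases t <;> simp [hx, s]
  refine hasHadamard_of_bordered (K := Fin (2 * h) × Bool) (L := Fin (2 * h) × Bool)
    (by simp; ring) (by simp; ring) (fun x => (decide (u x.1 = 1), x.2))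
    (fun x => (decide (u x.1 = 1), x.2)) (fun c => s c.1)
    (fun x y => if x.2 = y.2 then T x.1 y.1 else 0)
    (fun x y => if x.2 = y.2 then if x.1 = y.1 then 1 else 0 else
      if x.2 then -H y.1 x.1 else H x.1 y.1) ?_ ?_ ?_ ?_ ?_ ?_
  · rintro ⟨t, a⟩
    rw [Fintype.sum_prod_type]
    simp only [Prod.mk.injEq, ite_and, Fintype.sum_bool]
    rw [← hcount t]
    cases a <;> simp
  · rintro ⟨t, a⟩
    cases t <;> simp [s]
  · rintro ⟨x, a⟩ ⟨y, b⟩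
    by_cases hab : a = b
    · by_cases hxy : x = y
      · simp [hab, hxy, hTd]
      · simpa [hab, hxy] using hTo x y hxy
    · left
      rcases hH.1 x y with h1 | h1 <;> rcases hH.1 y x with h2 | h2 <;> cases a <;>
      simp [hab, h1, h2]
  · rintro ⟨x, a⟩ ⟨t, b⟩
    rw [Fintype.sum_prod_type]
    have := hsum t x
    cases a <;> cases b <;> simp [ite_and, this]
  · rintro ⟨x, a⟩ ⟨x', b⟩
    rw [Fintype.sum_prod_type]
    have := hTT x x'
    cases a <;> cases b <;> simp [this] <;>
    rcases hu x with h1 | h1 <;> rcases hu x' with h2 | h2 <;> simp [h1, h2] <;> ring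
  · rintro ⟨x, a⟩ ⟨x', b⟩
    rw [Fintype.sum_prod_type]
    have h1 := hrow x x'
    have h2 := hcol x x'
    cases a <;> cases b <;> simp [Finset.sum_add_distrib, h1, h2]
    all_goals split_ifs <;> ring

/-- Yamada's matrices, built from a conference matrix core and a pair of commuting symmetric
matrices. -/
theorem IsCore.hasHadamard_of_pair {ι : Type} [Fintype ι] [DecidableEq ι] {ε : ℤ}
    {S A B : ι → ι → ℤ} (hS : IsCore ε S) (hε : ε * ε = 1) (hAd : ∀ x, A x x = 0)
    (hAo : ∀ x y, x ≠ y → A x y = 1 ∨ A x y = -1) (hBo : ∀ x y, B x y = 1 ∨ B x y = -1)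
    (hA : ∀ x y, A y x = A x y) (hB : ∀ x y, B y x = B x y)
    (hAB : ∀ x y, ∑ z, A x z * B y z = ∑ z, B x z * A y z)
    (hsum : ∀ x y, ∑ z, (A x z * A y z + B x z * B y z) =
      if x = y then 2 * (Fintype.card ι : ℤ) - 1 else 0) :
    HasHadamard (4 * (2 * Fintype.card ι + 1)) := by
  have hε' : ε = 1 ∨ ε = -1 := mul_self_eq_one_iff.1 hε
  refine hasHadamard_of_bordered (K := Bool × Bool × ι) (L := Bool × Bool × ι)
    (by simp; ring) (by simp; ring) (fun r => (r.1, r.2.1))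
    (fun c => if c.1 then (false, c.2.1) else (true, !c.2.1)) 1
    (fun r c => if r.1 then
        if c.1 then (if !r.2.1 && c.2.1 then ε else -ε) * S r.2.2 c.2.2
        else if r.2.1 = c.2.1 then 0 else if r.2.2 = c.2.2 then 1 else 0
      else
        if c.1 then if r.2.1 = c.2.1 then if r.2.2 = c.2.2 then 1 else 0 else 0
        else (if r.2.1 && c.2.1 then -1 else 1) * S r.2.2 c.2.2)
    (fun r c => if r.1 = c.1 then
        (if r.2.1 && c.2.1 then -1 else 1) * if r.2.2 = c.2.2 then 1 else 0
      else if r.1 then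
        if r.2.1 = c.2.1 then (if r.2.1 then 1 else -1) * B r.2.2 c.2.2 else -A r.2.2 c.2.2
      else
        if r.2.1 = c.2.1 then (if r.2.1 then -1 else 1) * A r.2.2 c.2.2 else B r.2.2 c.2.2)
    ?_ ?_ ?_ ?_ ?_ ?_
  · rintro ⟨a, k⟩
    simp only [Fintype.sum_prod_type]
    cases a <;> cases k <;> simp
  · simp
  · rintro ⟨a, k, x⟩ ⟨b, l, y⟩
    by_cases hxy : x = y
    · subst hxy
      have h2 := hBo x x
      cases a <;> cases b <;> cases k <;> cases l <;>
      simp [hS.diag, hAd] <;> rcases h2 with h | h <;> simp [h]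
    · have h1 := hAo x y hxy
      have h2 := hBo x y
      have h3 := hS.off x y hxy
      cases a <;> cases b <;> cases k <;> cases l <;> simp [hxy] <;>
      rcases hε' with hε' | hε' <;> rcases h1 with h | h <;> rcases h2 with h' | h' <;>
      rcases h3 with h'' | h'' <;> simp [h, h', h'', hε']
  · rintro ⟨a, k, x⟩ ⟨b, l⟩
    simp only [Fintype.sum_prod_type]
    cases a <;> cases k <;> cases b <;> cases l <;> simp [← Finset.mul_sum, hS.row]
  · rintro ⟨a, k, x⟩ ⟨b, l, y⟩
    simp only [Fintype.sum_prod_type]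
    have h1 := hS.orth x y
    have h2 := hS.symm x y
    have h3 := hS.symm y x
    have h4 : ∑ z, ε * S x z * (ε * S y z) = ∑ z, S x z * S y z := by
      simp only [mul_mul_mul_comm, hε, one_mul]
    cases a <;> cases k <;> cases b <;> cases l <;> simp
    all_goals first
      | linarith
      | rw [h4, h1]; split_ifs <;> ring
      | rw [h1]; split_ifs <;> ring
  · rintro ⟨a, k, x⟩ ⟨b, l, y⟩
    simp only [Fintype.sum_prod_type]
    have h1 := hsum x y
    have h2 := hAB x y
    have h3 := hA x y
    have h4 := hB x y
    rw [Finset.sum_add_distrib] at h1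
    cases a <;> cases k <;> cases b <;> cases l <;> simp
    all_goals first
      | linarith
      | split_ifs at h1 ⊢ <;> linarith

/-- The digits of a pair of sequences with entries `0` (at the origin of the first one) and `±1`,
shifted by one. -/
def pairDigit (m : Fin 2 → ℕ) (t : Fin 2) (i : ℕ) : ℕ :=
  if t = 0 ∧ i = 0 then 1 else twiceBit (m t) i

theorem hasHadamard_of_pairDigit {ε : ℤ} (n l B c : ℕ) (m : Fin 2 → ℕ) [NeZero n]
    (hε : ε * ε = 1) (hS : HasCore ε n)
    (hl : n ≤ 2 ^ l) (hB : 2 * (n * 4) + 2 ≤ B) (hc : c + (2 * n - 1) + 2 ≤ B)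
    (hs : c + 2 * n = 2 * ∑ t, rangeSum l n (pairDigit m t))
    (h : (∑ t, rangeSum l n (fun i => pairDigit m t i * B ^ i) *
      rangeSum l n (fun i => pairDigit m t i * B ^ ((n - i) % n))) % (B ^ n - 1) =
        c * ((B ^ n - 1) / (B - 1)) + (2 * n - 1))
    (hsymm : ∀ i < n, ∀ t, pairDigit m t ((n - i) % n) = pairDigit m t i) :
    HasHadamard (4 * (2 * n + 1)) := by
  have hle (t : Fin 2) (i : ℕ) : pairDigit m t i ≤ 2 := by
    unfold pairDigit
    split_ifs
    · simp
    · exact twiceBit_le _ _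
  have hn : 1 ≤ 2 * n := by
    have := NeZero.pos n
    lia
  let a (t : Fin 2) (z : ZMod n) : ℤ := (pairDigit m t z.val : ℤ) - 1
  have hac (d : ZMod n) := sum_autocorrelation (pairDigit m) hle hl (by simpa using hB) hc
    (by simpa using hs) h d
  have ha (t z) : a t (-z) = a t z := by
    simp only [a, ZMod.neg_val', hsymm z.val (ZMod.val_lt z) t]
  have ha' (t) (x y : ZMod n) : a t (x - y) = a t (y - x) := by rw [← ha, neg_sub]
  have hsgn (t z) (hz : t ≠ 0 ∨ z ≠ 0) : a t z = 1 ∨ a t z = -1 := by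
    have : ¬(t = 0 ∧ z.val = 0) := by
      rw [ZMod.val_eq_zero]
      tauto
    rcases twiceBit_eq (m t) z.val with h | h <;> simp only [a, pairDigit, if_neg this, h] <;> simp
  obtain ⟨S, hS⟩ := hS.exists_isCore (ZMod n) (ZMod.card n)
  have key := hS.hasHadamard_of_pair (A := fun x y => a 0 (x - y)) (B := fun x y => a 1 (x - y)) hε
    (by simp [a, pairDigit]) (fun x y hxy => hsgn _ _ (Or.inr (sub_ne_zero.2 hxy)))
    (fun x y => hsgn _ _ (Or.inl one_ne_zero)) (fun x y => ha' _ _ _) (fun x y => ha' _ _ _)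
    (fun x y => ?_) fun x y => ?_
  · rwa [ZMod.card] at key
  · refine (Equiv.sum_comp (Equiv.subLeft (x + y)) _).symm.trans ?_
    refine Finset.sum_congr rfl fun z _ => ?_
    simp only [Equiv.subLeft_apply]
    rw [show x - (x + y - z) = z - y by ring, show y - (x + y - z) = z - x by ring, ha' 0 z y,
      ha' 1 z x, mul_comm]
  · have h1 (t) : ∑ z, a t (x - z) * a t (y - z) = ∑ z, a t z * a t (z + (y - x)) := by
      refine (Equiv.sum_comp (Equiv.subLeft x) _).symm.trans ?_
      refine Finset.sum_congr rfl fun z _ => ?_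
      simp only [Equiv.subLeft_apply]
      ring_nf
    have h2 := hac (y - x)
    rw [Fin.sum_univ_two] at h2
    rw [Finset.sum_add_distrib, h1, h1]
    refine h2.trans ?_
    rw [ZMod.card, Nat.cast_sub hn]
    simp [sub_eq_zero, eq_comm]

theorem hasHadamard_3292 : HasHadamard 3292 :=
  hasHadamard_of_pairDigit 411 9 4096 800
    ![1277835654654468460742073499306939530971937632534359638975359907349133966909643010669477311391004317474413438107434058364792,
      1324473433398402393746468602087351151327966095847753771604237654140421585512451446453600569130335130071556839774950602928133]
    (by norm_num) (HasSkewConference.hasCore hasSkewConference_412)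
    (by norm_num) (by norm_num) (by norm_num) (by decide +kernel) (by decide +kernel)
    (by decide +kernel)

theorem hasHadamard_3532 : HasHadamard 3532 :=
  hasHadamard_of_pairDigit 441 9 4096 964
    ![5289830811866591665151593081013379865825482442803346141271200021169575672829714959754275385530028986728126913257825203396929513438446,
      4190444755753874735517672184662687721871564795296629001720775654005964400270260766563548217319460403062303804136751947036840317857403]
    (by norm_num) hasCore_441
    (by norm_num) (by norm_num) (by norm_num) (by decide +kernel) (by decide +kernel)
    (by decide +kernel)

theorem hasHadamard_4252 : HasHadamard 4252 :=
  hasHadamard_of_pairDigit 531 10 8192 1104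
    ![4300904612053734545992241999930964096810642160511763286795728033925978165411241241230506092119254890075128217239422434484363342676474847415503374373288285375090,
      6967361224956329326426514942321281492665116368286086771490519302247899561422871383977258232354850262417978101557125768295090581455298108697596280257514856545151]
    (by norm_num) (HasSkewConference.hasCore hasSkewConference_532)
    (by norm_num) (by norm_num) (by norm_num) (by decide +kernel) (by decide +kernel)
    (by decide +kernel)

theorem hasHadamard_5212 : HasHadamard 5212 :=
  hasHadamard_of_pairDigit 651 10 8192 1200
    ![1420920036648658705698917463312710360965887714572742315573415806718085764681908885173334563325596990059893014025855622609791527441792714265435895980573217875393992671511841184264590072938502352584,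
      470118421903515773365580496433637275863765609985723844118853899935210750238083910081383410807243424446197594002604362912941748777692361321104705845804721819865836692809398337326297223976062357089]
    (by norm_num) (HasSkewConference.hasCore hasSkewConference_652)
    (by norm_num) (by norm_num) (by norm_num) (by decide +kernel) (by decide +kernel)
    (by decide +kernel)

theorem hasHadamard_8572 : HasHadamard 8572 :=
  hasHadamard_of_pairDigit 1071 11 16384 2224
    ![3071019551458827625248978665824175910091025509817272559164708015405082511200306197322870433392676687378284867396736419741232094573638882594285970545188323094085645551570475056967330234789143315678650537024244374342724723043711314624196117905072819781478717551366712851420846280885444777160665748951361234040293773616779760,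
      10651992751078635659747848168966203345076268870930467599542333120588783966610269063221936942835838856285400909786144407205804154729966967373870383398906181491053692881526030696972486311212635199850271513014345585189076328021506889522661462810523967652278621293563476747930329915554323687460197817346368652472481678461773741]
    (by norm_num) (HasSkewConference.hasCore hasSkewConference_268.two_mul.two_mul)
    (by norm_num) (by norm_num) (by norm_num) (by decide +kernel) (by decide +kernel)
    (by decide +kernel)

theorem hasHadamard_four_mul_of_prime {p : ℕ} (hp : p.Prime) (h4 : p % 4 = 1)
    (h : HasHadamard (p - 1)) : HasHadamard (4 * p) := by
  have hS := hasCore_of_prime hp (by lia)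
  rw [ZMod.χ₄_nat_one_mod_four h4] at hS
  obtain ⟨k, rfl⟩ : ∃ k, p = 2 * k + 1 := ⟨p / 2, by lia⟩
  exact hS.hasHadamard_four_mul h

theorem hasHadamard_add_one_of_prime {p : ℕ} (hp : p.Prime) (h4 : p % 4 = 3) :
    HasHadamard (p + 1) := by
  have hS := hasCore_of_prime hp (by lia)
  rw [ZMod.χ₄_nat_three_mod_four h4] at hS
  exact hS.hasHadamard_of_skew

theorem hasHadamard_two_mul_add_one_of_prime {p : ℕ} (hp : p.Prime) (h4 : p % 4 = 1) :
    HasHadamard (2 * (p + 1)) := by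
  have hS := hasCore_of_prime hp (by lia)
  rw [ZMod.χ₄_nat_one_mod_four h4] at hS
  exact hS.hasHadamard_of_symmetric

theorem hadamard_prop1 (n : ℕ) (hn : n ∈ ({787, 823, 883, 1063, 1303, 2143, 3533, 5441, 5449, 8237, 8573} : Finset ℕ)) :
    ∃ H : Matrix (Fin (4 * n)) (Fin (4 * n)) ℤ, IsHadamard (4 * n) H := by
  change HasHadamard (4 * n)
  simp only [Finset.mem_insert, Finset.mem_singleton] at hn
  rcases hn with rfl | rfl | rfl | rfl | rfl | rfl | rfl | rfl | rfl | rfl | rfl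
  · exact hasCore_1573.hasHadamard_of_symmetric
  · exact hasHadamard_3292
  · exact hasHadamard_3532
  · exact hasHadamard_4252
  · exact hasHadamard_5212
  · exact hasHadamard_8572
  · exact hasHadamard_four_mul_of_prime (by norm_num) (by norm_num) hasHadamard_3532
  · have h := hasHadamard_add_one_of_prime (p := 2719) (by norm_num) (by norm_num)
    exact hasHadamard_four_mul_of_prime (by norm_num) (by norm_num) h.two_mul
  · have h := hasHadamard_two_mul_add_one_of_prime (p := 1361) (by norm_num) (by norm_num)
    exact hasHadamard_four_mul_of_prime (by norm_num) (by norm_num) h.two_mul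
  · exact hasHadamard_four_mul_of_prime (by norm_num) (by norm_num) hasHadamard_8236
  · exact hasHadamard_four_mul_of_prime (by norm_num) (by norm_num) hasHadamard_8572
end

section
/- For each of the primes q = 509, 2389, 2693, 2917, 3037, there exist Williamson-type matrices of order q. -/
/-- Williamson-type matrices of order `n`: four `±1`-matrices, pairwise amicable,
with `A*Aᵀ + B*Bᵀ + C*Cᵀ + D*Dᵀ = 4n • I`. -/
def WilliamsonType (n : ℕ) : Prop :=
  ∃ A B C D : Matrix (Fin n) (Fin n) ℤ,
    (∀ i j, A i j = 1 ∨ A i j = -1) ∧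
    (∀ i j, B i j = 1 ∨ B i j = -1) ∧
    (∀ i j, C i j = 1 ∨ C i j = -1) ∧
    (∀ i j, D i j = 1 ∨ D i j = -1) ∧
    A * B.transpose = B * A.transpose ∧
    A * C.transpose = C * A.transpose ∧
    A * D.transpose = D * A.transpose ∧
    B * C.transpose = C * B.transpose ∧
    B * D.transpose = D * B.transpose ∧
    C * D.transpose = D * C.transpose ∧
    A * A.transpose + B * B.transpose + C * C.transpose + D * D.transpose
      = ((4 * n : ℕ) : ℤ) • 1

open Matrix Finset

/-- The all-ones matrix. -/
def onesMatrix (α β : Type*) : Matrix α β ℤ := of fun _ _ => 1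

/-- Symmetric commuting matrices `M`, `P` of order `m`, `M` with zero diagonal and all other
entries `±1`, satisfying `M * M + P * P = (2m + 1) • 1 - 2 • J` and with constant row sums
`-1` and `0`. -/
structure IsPaleyPair {ι : Type*} [Fintype ι] [DecidableEq ι] (M P : Matrix ι ι ℤ) : Prop where
  diag : ∀ i, M i i = 0
  sign_left : ∀ i j, i ≠ j → M i j = 1 ∨ M i j = -1
  sign_right : ∀ i j, P i j = 1 ∨ P i j = -1
  symm_left : Mᵀ = M
  symm_right : Pᵀ = P
  comm : M * P = P * M
  sum_left : ∀ i, ∑ j, M i j = -1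
  sum_right : ∀ i, ∑ j, P i j = 0
  sq : M * M + P * P = (2 * (Fintype.card ι : ℤ) + 1) • 1 - (2 : ℤ) • onesMatrix ι ι

/-- A matrix with zero diagonal, all other entries `±1`, and `W * Wᵀ = (n - 1) • 1`,
which is moreover skew-symmetric. -/
structure IsSkewConference {ι : Type*} [Fintype ι] [DecidableEq ι] (W : Matrix ι ι ℤ) : Prop where
  sign : ∀ i j, i ≠ j → W i j = 1 ∨ W i j = -1
  skew : Wᵀ = -W
  sq : W * W = (1 - (Fintype.card ι : ℤ)) • 1

/-- The skew-symmetric core of a normalized skew conference matrix. -/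
structure IsSkewCore {ι : Type*} [Fintype ι] [DecidableEq ι] (S : Matrix ι ι ℤ) : Prop where
  sign : ∀ i j, i ≠ j → S i j = 1 ∨ S i j = -1
  skew : Sᵀ = -S
  sum : ∀ i, ∑ j, S i j = 0
  sq : S * S = onesMatrix ι ι - (Fintype.card ι : ℤ) • 1

section FiniteField

variable {F : Type*} [Field F] [Fintype F] [DecidableEq F]

lemma quadraticChar_neg_eq (hF : Fintype.card F % 4 = 1) (x : F) :
    quadraticChar F (-x) = quadraticChar F x := by
  have h1 : quadraticChar F (-1) = 1 := by
    rw [quadraticChar_one_iff_isSquare (neg_ne_zero.mpr one_ne_zero),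
      FiniteField.isSquare_neg_one_iff]
    omega
  rw [← neg_one_mul, map_mul, h1, one_mul]

lemma quadraticChar_mul_self_eq_one {a : F} (ha : a ≠ 0) :
    quadraticChar F a * quadraticChar F a = 1 := by
  rw [← sq, quadraticChar_sq_one ha]

lemma sum_quadraticChar_sub_mul_quadraticChar_sub (hF : ringChar F ≠ 2) (a b : F) :
    ∑ x, quadraticChar F (a - x) * quadraticChar F (b - x) =
      if a = b then (Fintype.card F : ℤ) - 1 else -1 := by
  split_ifs with hab
  · subst hab
    have h : ∀ x : F, quadraticChar F (a - x) * quadraticChar F (a - x)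
        = 1 - if a = x then 1 else 0 := by
      intro x
      split_ifs with h
      · simp [h]
      · rw [quadraticChar_mul_self_eq_one (sub_ne_zero.mpr h), sub_zero]
    rw [sum_congr rfl fun x _ => h x]
    simp
  · have hab' : a - b ≠ 0 := sub_ne_zero.mpr hab
    have hinv : (quadraticChar F)⁻¹ = quadraticChar F :=
      (quadraticChar_isQuadratic F).inv
    have hJ := jacobiSum_nontrivial_inv (quadraticChar_ne_one hF)
    rw [hinv, jacobiSum] at hJ
    let e : F ≃ F := (Equiv.mulLeft₀ (a - b) hab').trans (Equiv.subLeft a)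
    have he : ∀ z, quadraticChar F (a - e z) * quadraticChar F (b - e z) =
        quadraticChar F (-1) * (quadraticChar F z * quadraticChar F (1 - z)) := by
      intro z
      have h1 : a - e z = (a - b) * z := by simp [e]
      have h2 : b - e z = -1 * ((a - b) * (1 - z)) := by simp [e]; ring
      rw [h1, h2]
      simp only [map_mul]
      linear_combination (quadraticChar F z * quadraticChar F (-1) * quadraticChar F (1 - z)) *
        quadraticChar_mul_self_eq_one hab'
    rw [← Equiv.sum_comp e]
    simp only [he]
    rw [← mul_sum, hJ]
    have := quadraticChar_mul_self_eq_one (F := F) (neg_ne_zero.mpr one_ne_zero)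
    linarith

lemma sum_eq_zero_add_sum_squares_add_sum_nonsquares {g : F} (hg : quadraticChar F g = -1)
    (f : F → ℤ) :
    ∑ x, f x = f 0 + ∑ u : {u : F // quadraticChar F u = 1}, f u
      + ∑ u : {u : F // quadraticChar F u = 1}, f (g / u) := by
  have hg0 : g ≠ 0 := by rintro rfl; simp at hg
  have hN : ∑ x with quadraticChar F x = -1, f x
      = ∑ x with quadraticChar F x = 1, f (g / x) := by
    have key : ∀ x : F, x ≠ 0 → quadraticChar F (g / x) * quadraticChar F x = -1 := by
      intro x hx
      rw [← map_mul, div_mul_cancel₀ _ hx, hg]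
    have h0 : ∀ (x : F) (c : ℤ), c ≠ 0 → quadraticChar F x = c → x ≠ 0 := by
      rintro x c hc hx rfl
      exact hc (by simpa using hx.symm)
    refine sum_nbij' (fun x => g / x) (fun x => g / x) ?_ ?_ ?_ ?_ ?_
    · intro x hx
      simp only [mem_filter, mem_univ, true_and] at hx ⊢
      have := key x (h0 _ _ (by norm_num) hx)
      rw [hx] at this
      linarith
    · intro x hx
      simp only [mem_filter, mem_univ, true_and] at hx ⊢
      have := key x (h0 _ _ (by norm_num) hx)
      rw [hx] at this
      linarith
    · intro x _
      exact div_div_cancel₀ hg0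
    · intro x _
      exact div_div_cancel₀ hg0
    · intro x _
      rw [div_div_cancel₀ hg0]
  rw [← sum_subtype (univ.filter fun u : F => quadraticChar F u = 1) (by simp) f,
    ← sum_subtype (univ.filter fun u : F => quadraticChar F u = 1) (by simp) fun u => f (g / u),
    ← hN]
  have hsplit : ∀ x : F, f x = (if x = 0 then f x else 0)
      + (if quadraticChar F x = 1 then f x else 0)
      + (if quadraticChar F x = -1 then f x else 0) := by
    intro x
    rcases eq_or_ne x 0 with rfl | hx
    · simp
    · rcases quadraticChar_dichotomy hx with h | h <;> simp [h, hx]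
  rw [sum_congr rfl fun x _ => hsplit x, sum_add_distrib, sum_add_distrib, sum_filter, sum_filter]
  simp

theorem exists_isPaleyPair (hF : Fintype.card F % 4 = 1) :
    ∃ M P : Matrix {u : F // quadraticChar F u = 1} {u : F // quadraticChar F u = 1} ℤ,
      IsPaleyPair M P ∧
      Fintype.card F = 2 * Fintype.card {u : F // quadraticChar F u = 1} + 1 := by
  have hF2 : ringChar F ≠ 2 := by
    intro h
    have := FiniteField.even_card_iff_char_two.mp h
    omega
  obtain ⟨g, hg⟩ := quadraticChar_exists_neg_one hF2
  have hg0 : g ≠ 0 := by rintro rfl; simp at hg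
  have hcard : Fintype.card F = 2 * Fintype.card {u : F // quadraticChar F u = 1} + 1 := by
    have := sum_eq_zero_add_sum_squares_add_sum_nonsquares hg fun _ => 1
    simp only [sum_const, card_univ, nsmul_eq_mul, mul_one] at this
    omega
  have hne : ∀ u : {u : F // quadraticChar F u = 1}, (u : F) ≠ 0 := by
    rintro ⟨u, hu⟩ rfl
    simp at hu
  have hdiv : ∀ a (u : {u : F // quadraticChar F u = 1}),
      quadraticChar F (a - g / u) = quadraticChar F (a * u - g) := by
    intro a u
    have h : a * u - g = (a - g / u) * u := by
      rw [sub_mul, div_mul_cancel₀ _ (hne u)]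
    rw [h, map_mul, u.2, mul_one]
  have hdiv' : ∀ a (u : {u : F // quadraticChar F u = 1}),
      quadraticChar F (g / u - a) = quadraticChar F (a * u - g) := by
    intro a u
    rw [← hdiv, ← neg_sub, quadraticChar_neg_eq hF]
  have hsub : ∀ a b : F, quadraticChar F (a - b) = quadraticChar F (b - a) := by
    intro a b
    rw [← neg_sub, quadraticChar_neg_eq hF]
  have hnsq : ∀ s t : {u : F // quadraticChar F u = 1}, (s * t - g : F) ≠ 0 := by
    intro s t h
    have : quadraticChar F (s * t) = -1 := by rw [sub_eq_zero.mp h, hg]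
    rw [map_mul, s.2, t.2] at this
    norm_num at this
  have hgdiv : ∀ u : {u : F // quadraticChar F u = 1}, quadraticChar F (g / u) = -1 := by
    intro u
    have h : quadraticChar F (g / u) * quadraticChar F u = -1 := by
      rw [← map_mul, div_mul_cancel₀ _ (hne u), hg]
    rwa [u.2, mul_one] at h
  have hsum : ∀ a : F, ∑ x, quadraticChar F (a - x) = 0 := fun a =>
    (Equiv.sum_comp (Equiv.subLeft a) fun x => quadraticChar F x).trans
      (quadraticChar_sum_zero hF2)
  have hS1 : ∀ s : {u : F // quadraticChar F u = 1},
      1 + ∑ u : {u : F // quadraticChar F u = 1}, quadraticChar F (s - u)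
        + ∑ u : {u : F // quadraticChar F u = 1}, quadraticChar F (s * u - g) = 0 := by
    intro s
    have h := sum_eq_zero_add_sum_squares_add_sum_nonsquares hg fun x => quadraticChar F (s - x)
    rw [hsum] at h
    simp only [hdiv, sub_zero, s.2] at h
    exact h.symm
  have hS2 : ∀ s : {u : F // quadraticChar F u = 1},
      -1 + ∑ u : {u : F // quadraticChar F u = 1}, quadraticChar F (s * u - g)
        - ∑ u : {u : F // quadraticChar F u = 1}, quadraticChar F (s - u) = 0 := by
    intro s
    have h := sum_eq_zero_add_sum_squares_add_sum_nonsquares hg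
      fun x => quadraticChar F (g / s - x)
    rw [hsum] at h
    have h2 : ∀ u : {u : F // quadraticChar F u = 1},
        quadraticChar F (g / s - g / u) = - quadraticChar F (s - u) := by
      intro u
      have h3 : g / s - g / u = (g / s) * ((u - s) * (u : F)⁻¹) := by
        field_simp [hne s, hne u]
      have h4 : quadraticChar F ((u : F)⁻¹) = 1 := by
        have h5 : quadraticChar F ((u : F)⁻¹) * quadraticChar F u = 1 := by
          rw [← map_mul, inv_mul_cancel₀ (hne u), map_one]
        rwa [u.2, mul_one] at h5
      rw [h3, map_mul, map_mul, hgdiv, h4, hsub u s]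
      ring
    simp only [h2] at h
    simp only [hdiv', sub_zero, hgdiv, sum_neg_distrib] at h
    simp only [mul_comm (s : F)]
    linarith
  refine ⟨of fun s t => quadraticChar F (s - t), of fun s t => quadraticChar F (s * t - g),
    ⟨?_, ?_, ?_, ?_, ?_, ?_, ?_, ?_, ?_⟩, hcard⟩
  · simp
  · intro s t hst
    exact quadraticChar_dichotomy (sub_ne_zero.mpr fun h => hst (Subtype.ext h))
  · intro s t
    exact quadraticChar_dichotomy (hnsq s t)
  · ext s t
    exact hsub t s
  · ext s t
    simp [mul_comm]
  · ext s t
    have h := sum_quadraticChar_sub_mul_quadraticChar_sub hF2 (s : F) (g / t)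
    have hst : (s : F) ≠ g / t := by
      intro h
      have := s.2
      rw [h, hgdiv] at this
      norm_num at this
    rw [if_neg hst, sum_eq_zero_add_sum_squares_add_sum_nonsquares hg] at h
    have h2 : ∀ u : {u : F // quadraticChar F u = 1},
        quadraticChar F (g / t - g / u) = - quadraticChar F (u - t) := by
      intro u
      have h3 : (g / t - g / u) * (t * u) = g * (u - t) := by
        field_simp [hne t, hne u]
      have h4 := congrArg (quadraticChar F) h3
      rw [map_mul, map_mul, map_mul, t.2, u.2, hg] at h4
      linarith
    simp only [h2] at h
    simp only [hdiv, hdiv', sub_zero, hgdiv, s.2, mul_neg, sum_neg_distrib] at h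
    simp only [mul_apply, of_apply]
    linarith
  · intro s
    simp only [of_apply]
    linarith [hS1 s, hS2 s]
  · intro s
    simp only [of_apply]
    linarith [hS1 s, hS2 s]
  · ext s t
    have h := sum_quadraticChar_sub_mul_quadraticChar_sub hF2 (s : F) t
    rw [sum_eq_zero_add_sum_squares_add_sum_nonsquares hg] at h
    simp only [hdiv, sub_zero, s.2, t.2, hcard, ← Subtype.ext_iff] at h
    simp only [Matrix.add_apply, Matrix.sub_apply, Matrix.smul_apply, mul_apply,
      of_apply, one_apply, onesMatrix]
    simp only [hsub _ (t : F), mul_comm _ (t : F)] at h ⊢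
    split_ifs at h ⊢ <;> push_cast at h ⊢ <;> simp only [smul_eq_mul] <;> linarith

theorem isSkewCore_quadraticChar (hF : Fintype.card F % 4 = 3) :
    IsSkewCore (of fun x y : F => quadraticChar F (x - y)) := by
  have hF2 : ringChar F ≠ 2 := by
    intro h
    have := FiniteField.even_card_iff_char_two.mp h
    omega
  have hneg : ∀ x : F, quadraticChar F (-x) = - quadraticChar F x := by
    intro x
    have h1 : quadraticChar F (-1) = -1 := by
      rw [quadraticChar_neg_one_iff_not_isSquare, FiniteField.isSquare_neg_one_iff]
      omega
    rw [← neg_one_mul, map_mul, h1, neg_one_mul]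
  refine ⟨?_, ?_, ?_, ?_⟩
  · intro x y hxy
    exact quadraticChar_dichotomy (sub_ne_zero.mpr hxy)
  · ext x y
    simp only [transpose_apply, of_apply, Matrix.neg_apply]
    rw [← neg_sub, hneg]
  · intro x
    simp only [of_apply]
    exact (Equiv.sum_comp (Equiv.subLeft x) fun x => quadraticChar F x).trans
      (quadraticChar_sum_zero hF2)
  · ext x y
    have h := sum_quadraticChar_sub_mul_quadraticChar_sub hF2 x y
    simp only [Matrix.sub_apply, Matrix.smul_apply, mul_apply,
      of_apply, one_apply, onesMatrix]
    have h2 : ∀ j, quadraticChar F (j - y) = - quadraticChar F (y - j) := by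
      intro j
      rw [← neg_sub, hneg]
    simp only [h2, mul_neg, sum_neg_distrib, h]
    split_ifs <;> simp

end FiniteField

section OnesMatrix

variable {α β γ : Type*}

lemma onesMatrix_transpose : (onesMatrix α β)ᵀ = onesMatrix β α := rfl

lemma onesMatrix_mul_onesMatrix [Fintype β] :
    onesMatrix α β * onesMatrix β γ = (Fintype.card β : ℤ) • onesMatrix α γ := by
  ext i j
  simp [onesMatrix, mul_apply]

lemma mul_onesMatrix_of_sum_eq [Fintype β] {M : Matrix α β ℤ} {c : ℤ} (h : ∀ i, ∑ j, M i j = c) :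
    M * onesMatrix β γ = c • onesMatrix α γ := by
  ext i j
  simp [onesMatrix, mul_apply, h]

lemma onesMatrix_mul_of_sum_eq [Fintype β] {M : Matrix β α ℤ} {c : ℤ}
    (h : ∀ i, ∑ j, Mᵀ i j = c) : onesMatrix γ β * M = c • onesMatrix γ α := by
  rw [← transpose_inj, transpose_mul, transpose_smul, onesMatrix_transpose, onesMatrix_transpose,
    mul_onesMatrix_of_sum_eq h]

lemma onesMatrix_self [Unique α] [DecidableEq α] : onesMatrix α α = 1 := by
  ext i j
  rw [Subsingleton.elim i j, one_apply_eq]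
  rfl

lemma onesMatrix_sign (i : α) (j : β) : onesMatrix α β i j = 1 ∨ onesMatrix α β i j = -1 :=
  Or.inl rfl

end OnesMatrix

lemma fromBlocks_sign {α β γ δ : Type*} {A : Matrix α γ ℤ} {B : Matrix α δ ℤ} {C : Matrix β γ ℤ}
    {D : Matrix β δ ℤ} (hA : ∀ i j, A i j = 1 ∨ A i j = -1) (hB : ∀ i j, B i j = 1 ∨ B i j = -1)
    (hC : ∀ i j, C i j = 1 ∨ C i j = -1) (hD : ∀ i j, D i j = 1 ∨ D i j = -1) (i : α ⊕ β)
    (j : γ ⊕ δ) : fromBlocks A B C D i j = 1 ∨ fromBlocks A B C D i j = -1 := by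
  rcases i with i | i <;> rcases j with j | j
  · exact hA i j
  · exact hB i j
  · exact hC i j
  · exact hD i j

lemma fromBlocks_sub_fromBlocks {α β γ δ : Type*} (A A' : Matrix α γ ℤ) (B B' : Matrix α δ ℤ)
    (C C' : Matrix β γ ℤ) (D D' : Matrix β δ ℤ) :
    fromBlocks A B C D - fromBlocks A' B' C' D' =
      fromBlocks (A - A') (B - B') (C - C') (D - D') := by
  rw [sub_eq_add_neg, fromBlocks_neg, fromBlocks_add]
  simp only [sub_eq_add_neg]

lemma neg_sign {α β : Type*} {A : Matrix α β ℤ} (hA : ∀ i j, A i j = 1 ∨ A i j = -1) (i : α)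
    (j : β) : (-A) i j = 1 ∨ (-A) i j = -1 := by
  rw [Matrix.neg_apply]
  rcases hA i j with h | h <;> simp [h]

/-- `[a, b, b; c, U + V, U - V; c, U - V, U + V]`. -/
def borderedMatrix {α ι : Type*} (a : Matrix α α ℤ) (b : Matrix α ι ℤ) (c : Matrix ι α ℤ)
    (U V : Matrix ι ι ℤ) : Matrix (α ⊕ (ι ⊕ ι)) (α ⊕ (ι ⊕ ι)) ℤ :=
  fromBlocks a (fromCols b b) (fromRows c c) (fromBlocks (U + V) (U - V) (U - V) (U + V))

section Bordered

variable {α ι : Type*}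

lemma borderedMatrix_transpose (a : Matrix α α ℤ) (b : Matrix α ι ℤ) (c : Matrix ι α ℤ)
    (U V : Matrix ι ι ℤ) :
    (borderedMatrix a b c U V)ᵀ = borderedMatrix aᵀ cᵀ bᵀ Uᵀ Vᵀ := by
  simp [borderedMatrix, fromBlocks_transpose, transpose_fromCols, transpose_fromRows]

lemma borderedMatrix_add (a a' : Matrix α α ℤ) (b b' : Matrix α ι ℤ) (c c' : Matrix ι α ℤ)
    (U V U' V' : Matrix ι ι ℤ) :
    borderedMatrix a b c U V + borderedMatrix a' b' c' U' V' =
      borderedMatrix (a + a') (b + b') (c + c') (U + U') (V + V') := by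
  ext (i | i | i) (j | j | j) <;> simp [borderedMatrix] <;> ring

lemma borderedMatrix_mul [Fintype α] [Fintype ι] (a a' : Matrix α α ℤ) (b b' : Matrix α ι ℤ)
    (c c' : Matrix ι α ℤ) (U V U' V' : Matrix ι ι ℤ) :
    borderedMatrix a b c U V * borderedMatrix a' b' c' U' V' =
      borderedMatrix (a * a' + 2 • (b * c')) (a * b' + 2 • (b * U')) (c * a' + 2 • (U * c'))
        (c * b' + 2 • (U * U')) (2 • (V * V')) := by
  simp only [borderedMatrix, fromBlocks_multiply, mul_fromCols, fromRows_mul, fromCols_mul_fromRows,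
    fromCols_mul_fromBlocks, fromBlocks_mul_fromRows, fromCols_fromRows_eq_fromBlocks,
    fromBlocks_add]
  congr 1
  · rw [two_nsmul]
  · ext i (j | j) <;> simp [Matrix.mul_add, Matrix.mul_sub] <;> ring
  · ext (i | i) j <;> simp [Matrix.add_mul, Matrix.sub_mul] <;> ring
  · congr 1 <;> simp only [Matrix.mul_add, Matrix.mul_sub, Matrix.add_mul, Matrix.sub_mul] <;> abel

lemma borderedMatrix_smul_one [DecidableEq α] [DecidableEq ι] (k : ℤ) :
    borderedMatrix ((2 * k) • (1 : Matrix α α ℤ)) 0 0 (k • (1 : Matrix ι ι ℤ)) (k • 1) =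
      (2 * k) • 1 := by
  rw [borderedMatrix, sub_self, ← two_smul ℤ, smul_smul, fromCols_zero, fromRows_zero,
    ← fromBlocks_one, fromBlocks_smul, ← fromBlocks_one, fromBlocks_smul]
  simp

lemma borderedMatrix_sign {a : Matrix α α ℤ} {b : Matrix α ι ℤ} {c : Matrix ι α ℤ}
    {U V : Matrix ι ι ℤ} (ha : ∀ i j, a i j = 1 ∨ a i j = -1) (hb : ∀ i j, b i j = 1 ∨ b i j = -1)
    (hc : ∀ i j, c i j = 1 ∨ c i j = -1)
    (hUV : ∀ i j, (U i j = 0 ∧ (V i j = 1 ∨ V i j = -1)) ∨ ((U i j = 1 ∨ U i j = -1) ∧ V i j = 0))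
    (i j : α ⊕ (ι ⊕ ι)) :
    borderedMatrix a b c U V i j = 1 ∨ borderedMatrix a b c U V i j = -1 := by
  have hadd : ∀ i j, (U + V) i j = 1 ∨ (U + V) i j = -1 := by
    intro i j
    have := hUV i j
    rw [Matrix.add_apply]
    omega
  have hsub : ∀ i j, (U - V) i j = 1 ∨ (U - V) i j = -1 := by
    intro i j
    have := hUV i j
    rw [Matrix.sub_apply]
    omega
  refine fromBlocks_sign ha ?_ ?_ (fromBlocks_sign hadd hsub hsub hadd) i j
  · rintro i (j | j) <;> exact hb i j
  · rintro (i | i) j <;> exact hc i j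

end Bordered

/-- Symmetric commuting `±1`-matrices `X`, `Y` of order `n` with `X * X + Y * Y = 2n • 1`;
equivalently, `X + iY` is, up to the factor `1 + i`, a symmetric quaternary complex Hadamard
matrix. -/
structure IsComplexHadamardPair {ι : Type*} [Fintype ι] [DecidableEq ι] (X Y : Matrix ι ι ℤ) :
    Prop where
  sign_left : ∀ i j, X i j = 1 ∨ X i j = -1
  sign_right : ∀ i j, Y i j = 1 ∨ Y i j = -1
  symm_left : Xᵀ = X
  symm_right : Yᵀ = Y
  comm : X * Y = Y * X
  sq : X * X + Y * Y = (2 * (Fintype.card ι : ℤ)) • 1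

/-- A symmetric Hadamard matrix. -/
structure IsSymmHadamard {ι : Type*} [Fintype ι] [DecidableEq ι] (K : Matrix ι ι ℤ) : Prop where
  sign : ∀ i j, K i j = 1 ∨ K i j = -1
  symm : Kᵀ = K
  sq : K * K = (Fintype.card ι : ℤ) • 1

/-- There is a complex Hadamard pair of order `n`. -/
def ComplexHadamardOrder (n : ℕ) : Prop :=
  ∃ X Y : Matrix (Fin n) (Fin n) ℤ, IsComplexHadamardPair X Y

/-- There is a skew core of order `n`. -/
def SkewCoreOrder (n : ℕ) : Prop :=
  ∃ S : Matrix (Fin n) (Fin n) ℤ, IsSkewCore S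

section Reindex

variable {ι κ : Type*} [Fintype ι] [DecidableEq ι] [Fintype κ] [DecidableEq κ]

lemma IsComplexHadamardPair.submatrix {X Y : Matrix ι ι ℤ} (h : IsComplexHadamardPair X Y)
    (e : κ ≃ ι) : IsComplexHadamardPair (X.submatrix e e) (Y.submatrix e e) := by
  refine ⟨fun i j => h.sign_left _ _, fun i j => h.sign_right _ _, ?_, ?_, ?_, ?_⟩
  · rw [transpose_submatrix, h.symm_left]
  · rw [transpose_submatrix, h.symm_right]
  · simp only [submatrix_mul_equiv, h.comm]
  · simp only [submatrix_mul_equiv]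
    rw [← submatrix_one_equiv e, Fintype.card_congr e]
    exact congrArg (fun A : Matrix ι ι ℤ => A.submatrix e e) h.sq

lemma IsSymmHadamard.submatrix {K : Matrix ι ι ℤ} (h : IsSymmHadamard K) (e : κ ≃ ι) :
    IsSymmHadamard (K.submatrix e e) := by
  refine ⟨fun i j => h.sign _ _, ?_, ?_⟩
  · rw [transpose_submatrix, h.symm]
  · rw [submatrix_mul_equiv, ← submatrix_one_equiv e, Fintype.card_congr e]
    exact congrArg (fun A : Matrix ι ι ℤ => A.submatrix e e) h.sq

lemma IsSkewCore.submatrix {S : Matrix ι ι ℤ} (h : IsSkewCore S) (e : κ ≃ ι) :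
    IsSkewCore (S.submatrix e e) := by
  refine ⟨fun i j hij => h.sign _ _ (e.injective.ne hij), ?_, ?_, ?_⟩
  · rw [transpose_submatrix, h.skew]
    rfl
  · intro i
    exact (Equiv.sum_comp e fun j => S (e i) j).trans (h.sum _)
  · rw [submatrix_mul_equiv, ← submatrix_one_equiv e, Fintype.card_congr e]
    exact congrArg (fun A : Matrix ι ι ℤ => A.submatrix e e) h.sq

lemma IsComplexHadamardPair.order {X Y : Matrix ι ι ℤ} (h : IsComplexHadamardPair X Y) {n : ℕ}
    (hn : Fintype.card ι = n) : ComplexHadamardOrder n :=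
  ⟨_, _, h.submatrix (Fintype.equivFinOfCardEq hn).symm⟩

lemma IsSkewCore.order {S : Matrix ι ι ℤ} (h : IsSkewCore S) {n : ℕ}
    (hn : Fintype.card ι = n) : SkewCoreOrder n :=
  ⟨_, h.submatrix (Fintype.equivFinOfCardEq hn).symm⟩

lemma WilliamsonType.of_card_eq {n : ℕ} (hn : Fintype.card ι = n) (A B C D : Matrix ι ι ℤ)
    (hA : ∀ i j, A i j = 1 ∨ A i j = -1) (hB : ∀ i j, B i j = 1 ∨ B i j = -1)
    (hC : ∀ i j, C i j = 1 ∨ C i j = -1) (hD : ∀ i j, D i j = 1 ∨ D i j = -1)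
    (hAB : A * Bᵀ = B * Aᵀ) (hAC : A * Cᵀ = C * Aᵀ) (hAD : A * Dᵀ = D * Aᵀ)
    (hBC : B * Cᵀ = C * Bᵀ) (hBD : B * Dᵀ = D * Bᵀ) (hCD : C * Dᵀ = D * Cᵀ)
    (hsum : A * Aᵀ + B * Bᵀ + C * Cᵀ + D * Dᵀ = (4 * (n : ℤ)) • 1) : WilliamsonType n := by
  let e : Fin n ≃ ι := (Fintype.equivFinOfCardEq hn).symm
  refine ⟨A.submatrix e e, B.submatrix e e, C.submatrix e e, D.submatrix e e,
    fun i j => hA _ _, fun i j => hB _ _, fun i j => hC _ _, fun i j => hD _ _,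
    ?_, ?_, ?_, ?_, ?_, ?_, ?_⟩
  · simp only [transpose_submatrix, submatrix_mul_equiv, hAB]
  · simp only [transpose_submatrix, submatrix_mul_equiv, hAC]
  · simp only [transpose_submatrix, submatrix_mul_equiv, hAD]
  · simp only [transpose_submatrix, submatrix_mul_equiv, hBC]
  · simp only [transpose_submatrix, submatrix_mul_equiv, hBD]
  · simp only [transpose_submatrix, submatrix_mul_equiv, hCD]
  · simp only [transpose_submatrix, submatrix_mul_equiv]
    rw [← submatrix_one_equiv e]
    push_cast
    exact congrArg (fun A : Matrix ι ι ℤ => A.submatrix e e) hsum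

end Reindex

section Constructions

variable {ι : Type*} [Fintype ι] [DecidableEq ι]

lemma ComplexHadamardOrder.double {n : ℕ} (h : ComplexHadamardOrder n) :
    ComplexHadamardOrder (2 * n) := by
  obtain ⟨X, Y, h⟩ := h
  refine IsComplexHadamardPair.order (X := fromBlocks X X X (-X)) (Y := fromBlocks Y Y Y (-Y))
    ⟨fromBlocks_sign h.sign_left h.sign_left h.sign_left (neg_sign h.sign_left),
      fromBlocks_sign h.sign_right h.sign_right h.sign_right (neg_sign h.sign_right), ?_, ?_, ?_,
      ?_⟩ (by simp; ring)
  · rw [fromBlocks_transpose, transpose_neg, h.symm_left]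
  · rw [fromBlocks_transpose, transpose_neg, h.symm_right]
  · simp [fromBlocks_multiply, h.comm]
  · rw [← fromBlocks_one, fromBlocks_smul]
    simp only [fromBlocks_multiply, fromBlocks_add, Matrix.mul_neg, Matrix.neg_mul, neg_neg,
      smul_zero, fromBlocks_inj, eq_sub_of_add_eq h.sq, Fintype.card_sum]
    push_cast
    refine ⟨?_, ?_, ?_, ?_⟩ <;> module

lemma ComplexHadamardOrder.exists_isSymmHadamard {n : ℕ} (h : ComplexHadamardOrder n)
    (hn : Fintype.card ι = 2 * n) : ∃ K : Matrix ι ι ℤ, IsSymmHadamard K := by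
  obtain ⟨X, Y, h⟩ := h
  have hK : IsSymmHadamard (fromBlocks X Y Y (-X)) := by
    refine ⟨fromBlocks_sign h.sign_left h.sign_right h.sign_right (neg_sign h.sign_left), ?_, ?_⟩
    · rw [fromBlocks_transpose, transpose_neg, h.symm_left, h.symm_right]
    · rw [← fromBlocks_one, fromBlocks_smul]
      simp only [fromBlocks_multiply, Matrix.mul_neg, Matrix.neg_mul, neg_neg, smul_zero,
        fromBlocks_inj, eq_sub_of_add_eq h.sq, h.comm, Fintype.card_sum]
      push_cast
      refine ⟨?_, ?_, ?_, ?_⟩ <;> module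
  exact ⟨_, hK.submatrix (Fintype.equivOfCardEq (by simp [hn, two_mul]))⟩

/-- Symmetric commuting matrices `A`, `B` of order `r` with `A * A + B * B = (2r - 1) • 1`. -/
structure IsTurynPair (A B : Matrix ι ι ℤ) : Prop where
  diag : ∀ i, A i i = 0
  sign_left : ∀ i j, i ≠ j → A i j = 1 ∨ A i j = -1
  sign_right : ∀ i j, B i j = 1 ∨ B i j = -1
  symm_left : Aᵀ = A
  symm_right : Bᵀ = B
  comm : A * B = B * A
  sq : A * A + B * B = (2 * (Fintype.card ι : ℤ) - 1) • 1

lemma IsPaleyPair.left_mul_ones {M P : Matrix ι ι ℤ} (h : IsPaleyPair M P) (γ : Type*) :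
    M * onesMatrix ι γ = -onesMatrix ι γ := by
  rw [mul_onesMatrix_of_sum_eq h.sum_left, neg_one_smul]

lemma IsPaleyPair.right_mul_ones {M P : Matrix ι ι ℤ} (h : IsPaleyPair M P) (γ : Type*) :
    P * onesMatrix ι γ = 0 := by
  rw [mul_onesMatrix_of_sum_eq h.sum_right, zero_smul]

lemma IsPaleyPair.ones_mul_left {M P : Matrix ι ι ℤ} (h : IsPaleyPair M P) (γ : Type*) :
    onesMatrix γ ι * M = -onesMatrix γ ι := by
  rw [onesMatrix_mul_of_sum_eq (c := -1) (by simpa only [h.symm_left] using h.sum_left),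
    neg_one_smul]

lemma IsPaleyPair.ones_mul_right {M P : Matrix ι ι ℤ} (h : IsPaleyPair M P) (γ : Type*) :
    onesMatrix γ ι * P = 0 := by
  rw [onesMatrix_mul_of_sum_eq (c := 0) (by simpa only [h.symm_right] using h.sum_right),
    zero_smul]

lemma IsPaleyPair.isTurynPair {M P : Matrix ι ι ℤ} (h : IsPaleyPair M P) :
    IsTurynPair (fromBlocks 0 (onesMatrix Unit ι) (onesMatrix ι Unit) M)
      (fromBlocks (onesMatrix Unit Unit) (onesMatrix Unit ι) (onesMatrix ι Unit) P) := by
  refine ⟨?_, ?_, ?_, ?_, ?_, ?_, ?_⟩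
  · rintro (i | i)
    · rfl
    · exact h.diag i
  · rintro (i | i) (j | j) hij
    · exact absurd rfl hij
    · exact Or.inl rfl
    · exact Or.inl rfl
    · exact h.sign_left i j fun h => hij (congrArg _ h)
  · exact fromBlocks_sign onesMatrix_sign onesMatrix_sign onesMatrix_sign h.sign_right
  · rw [fromBlocks_transpose, h.symm_left]
    rfl
  · rw [fromBlocks_transpose, h.symm_right]
    rfl
  · simp only [fromBlocks_multiply, onesMatrix_mul_onesMatrix, h.left_mul_ones, h.right_mul_ones,
      h.ones_mul_left, h.ones_mul_right, h.comm, Matrix.zero_mul, Matrix.mul_zero, fromBlocks_inj]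
    simp
  · rw [← fromBlocks_one, fromBlocks_smul]
    simp only [fromBlocks_multiply, fromBlocks_add, onesMatrix_mul_onesMatrix, h.left_mul_ones,
      h.right_mul_ones, h.ones_mul_left, h.ones_mul_right, Matrix.zero_mul, Matrix.mul_zero,
      fromBlocks_inj]
    refine ⟨?_, ?_, ?_, ?_⟩
    · rw [onesMatrix_self, ← add_smul, zero_add, ← Int.cast_one (R := ℤ)]
      simp only [Fintype.card_sum, Fintype.card_unit]
      push_cast
      module
    · simp
    · simp
    · have h2 := eq_sub_of_add_eq h.sq
      rw [h2]
      simp only [Fintype.card_sum, Fintype.card_unit]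
      push_cast
      module

lemma IsTurynPair.complexHadamardOrder {A B : Matrix ι ι ℤ} (h : IsTurynPair A B) {n : ℕ}
    (hn : 2 * Fintype.card ι = n) : ComplexHadamardOrder n := by
  have hadd : ∀ i j, (A + 1) i j = 1 ∨ (A + 1) i j = -1 := by
    intro i j
    rcases eq_or_ne i j with rfl | hij
    · simp [h.diag]
    · simpa [hij] using h.sign_left i j hij
  have hsub : ∀ i j, (A - 1) i j = 1 ∨ (A - 1) i j = -1 := by
    intro i j
    rcases eq_or_ne i j with rfl | hij
    · simp [h.diag]
    · simpa [hij] using h.sign_left i j hij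
  have hneg : ∀ i j, (1 - A) i j = 1 ∨ (1 - A) i j = -1 := by
    rw [← neg_sub]
    exact neg_sign hsub
  have hneg' : ∀ i j, (-A - 1) i j = 1 ∨ (-A - 1) i j = -1 := by
    rw [← neg_add']
    exact neg_sign hadd
  refine IsComplexHadamardPair.order (X := fromBlocks (A + 1) B B (1 - A))
    (Y := fromBlocks (A - 1) B B (-A - 1))
    ⟨fromBlocks_sign hadd h.sign_right h.sign_right hneg,
      fromBlocks_sign hsub h.sign_right h.sign_right hneg', ?_, ?_, ?_, ?_⟩
    (by rw [Fintype.card_sum, ← hn, two_mul])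
  · simp [fromBlocks_transpose, h.symm_left, h.symm_right]
  · simp [fromBlocks_transpose, h.symm_left, h.symm_right]
  · simp only [fromBlocks_multiply, fromBlocks_inj]
    refine ⟨?_, ?_, ?_, ?_⟩ <;> simp only [Matrix.mul_add, Matrix.mul_sub, Matrix.add_mul,
      Matrix.sub_mul, Matrix.mul_neg, Matrix.neg_mul, Matrix.mul_one, Matrix.one_mul, h.comm] <;>
      abel
  · rw [← fromBlocks_one, fromBlocks_smul]
    have h2 := eq_sub_of_add_eq h.sq
    simp only [fromBlocks_multiply, fromBlocks_add, fromBlocks_inj, Matrix.mul_add,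
      Matrix.mul_sub, Matrix.add_mul, Matrix.sub_mul, Matrix.mul_neg, Matrix.neg_mul,
      Matrix.mul_one, Matrix.one_mul, h.comm, h2, Fintype.card_sum]
    push_cast
    refine ⟨?_, ?_, ?_, ?_⟩ <;> module

lemma IsPaleyPair.williamsonType {M P X Y : Matrix ι ι ℤ} (h : IsPaleyPair M P)
    (hXY : IsComplexHadamardPair X Y) {q : ℕ} (hq : 2 * Fintype.card ι + 1 = q) :
    WilliamsonType q := by
  have hJ := onesMatrix_sign (α := Unit) (β := Unit)
  have hR := onesMatrix_sign (α := Unit) (β := ι)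
  have hC := onesMatrix_sign (α := ι) (β := Unit)
  refine WilliamsonType.of_card_eq (ι := Unit ⊕ (ι ⊕ ι))
    (by rw [← hq]; simp only [Fintype.card_sum, Fintype.card_unit]; ring)
    (borderedMatrix (-onesMatrix Unit Unit) (onesMatrix Unit ι) (onesMatrix ι Unit) M 1)
    (borderedMatrix (onesMatrix Unit Unit) (onesMatrix Unit ι) (onesMatrix ι Unit) P 0)
    (borderedMatrix (onesMatrix Unit Unit) (onesMatrix Unit ι) (onesMatrix ι Unit) 0 X)
    (borderedMatrix (onesMatrix Unit Unit) (onesMatrix Unit ι) (onesMatrix ι Unit) 0 Y)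
    (borderedMatrix_sign (neg_sign hJ) hR hC ?_) (borderedMatrix_sign hJ hR hC ?_)
    (borderedMatrix_sign hJ hR hC ?_) (borderedMatrix_sign hJ hR hC ?_) ?_ ?_ ?_ ?_ ?_ ?_ ?_
  · intro i j
    rcases eq_or_ne i j with rfl | hij
    · simp [h.diag]
    · simpa [hij] using h.sign_left i j hij
  · simpa using h.sign_right
  · simpa using hXY.sign_left
  · simpa using hXY.sign_right
  all_goals
    simp only [borderedMatrix_transpose, borderedMatrix_mul, borderedMatrix_add,
      onesMatrix_transpose, h.symm_left, h.symm_right,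
      transpose_neg, transpose_zero, transpose_one, onesMatrix_mul_onesMatrix,
      h.left_mul_ones, h.right_mul_ones, h.ones_mul_left, h.ones_mul_right, h.comm,
      hXY.comm, hXY.symm_left, hXY.symm_right, Matrix.mul_zero, Matrix.zero_mul, Matrix.mul_neg,
      Matrix.neg_mul, Matrix.mul_one, Matrix.one_mul, neg_neg, nsmul_zero, add_zero]
  iterate 3 congr 1
  rw [show (4 * (q : ℤ)) = 2 * (2 * q) by ring, ← borderedMatrix_smul_one]
  have h1 := eq_sub_of_add_eq h.sq
  have h2 := eq_sub_of_add_eq hXY.sq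
  rw [h1, h2, onesMatrix_self, ← hq]
  push_cast
  simp only [Fintype.card_unit]
  congr 1 <;> module

/-- The blocks of a symmetric complex Hadamard pair of order `2 + 4r` with a border of width `2`. -/
structure IsBorderBlocks (ε : ℤ) (U V U' V' : Matrix (ι ⊕ ι) (ι ⊕ ι) ℤ) : Prop where
  sign_left : ∀ i j,
    (U i j = 0 ∧ (V i j = 1 ∨ V i j = -1)) ∨ ((U i j = 1 ∨ U i j = -1) ∧ V i j = 0)
  sign_right : ∀ i j,
    (U' i j = 0 ∧ (V' i j = 1 ∨ V' i j = -1)) ∨ ((U' i j = 1 ∨ U' i j = -1) ∧ V' i j = 0)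
  symm₁ : Uᵀ = U
  symm₂ : Vᵀ = V
  symm₃ : U'ᵀ = U'
  symm₄ : V'ᵀ = V'
  comm_left : U * U' = U' * U
  comm_right : V * V' = V' * V
  sum_left : U * fromBlocks (onesMatrix ι Unit) (onesMatrix ι Unit) (onesMatrix ι Unit)
      (-onesMatrix ι Unit) = ε • fromBlocks (onesMatrix ι Unit) (onesMatrix ι Unit) 0 0
  sum_right : U' * fromBlocks (onesMatrix ι Unit) (onesMatrix ι Unit) (onesMatrix ι Unit)
      (-onesMatrix ι Unit) = ε • fromBlocks 0 0 (-onesMatrix ι Unit) (onesMatrix ι Unit)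
  sq_left : U * U + U' * U' = (2 * (Fintype.card ι : ℤ) + 1) • 1
    - (2 : ℤ) • fromBlocks (onesMatrix ι ι) 0 0 (onesMatrix ι ι)
  sq_right : V * V + V' * V' = (2 * (Fintype.card ι : ℤ) + 1) • 1

lemma IsBorderBlocks.complexHadamardOrder {ε : ℤ} (hε : ε = 1 ∨ ε = -1)
    {U V U' V' : Matrix (ι ⊕ ι) (ι ⊕ ι) ℤ} (h : IsBorderBlocks ε U V U' V') {n : ℕ}
    (hn : 2 + 4 * Fintype.card ι = n) : ComplexHadamardOrder n := by
  have hε2 : ε * ε = 1 := by rcases hε with rfl | rfl <;> norm_num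
  let a : Matrix (Unit ⊕ Unit) (Unit ⊕ Unit) ℤ := ε • fromBlocks 1 (-1) (-1) 1
  let a' : Matrix (Unit ⊕ Unit) (Unit ⊕ Unit) ℤ := ε • fromBlocks (-1) (-1) (-1) (-1)
  let b : Matrix (Unit ⊕ Unit) (ι ⊕ ι) ℤ := fromBlocks (onesMatrix Unit ι) (onesMatrix Unit ι)
    (onesMatrix Unit ι) (-onesMatrix Unit ι)
  let c : Matrix (ι ⊕ ι) (Unit ⊕ Unit) ℤ := fromBlocks (onesMatrix ι Unit) (onesMatrix ι Unit)
    (onesMatrix ι Unit) (-onesMatrix ι Unit)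
  have hb : bᵀ = c := by simp [b, c, fromBlocks_transpose, onesMatrix_transpose]
  have hc : cᵀ = b := by simp [b, c, fromBlocks_transpose, onesMatrix_transpose]
  have ha : aᵀ = a := by
    simp only [a, transpose_smul, fromBlocks_transpose, transpose_neg, transpose_one]
  have ha' : a'ᵀ = a' := by
    simp only [a', transpose_smul, fromBlocks_transpose, transpose_neg, transpose_one]
  have hUc : U * c = ε • fromBlocks (onesMatrix ι Unit) (onesMatrix ι Unit) 0 0 := h.sum_left
  have hUc' : U' * c = ε • fromBlocks 0 0 (-onesMatrix ι Unit) (onesMatrix ι Unit) := h.sum_right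
  have hbU : b * U = ε • fromBlocks (onesMatrix Unit ι) 0 (onesMatrix Unit ι) 0 := by
    rw [← transpose_inj, transpose_mul, hb, h.symm₁, hUc, transpose_smul, fromBlocks_transpose]
    rfl
  have hbU' : b * U' = ε • fromBlocks 0 (-onesMatrix Unit ι) 0 (onesMatrix Unit ι) := by
    rw [← transpose_inj, transpose_mul, hb, h.symm₃, hUc', transpose_smul, fromBlocks_transpose]
    rfl
  have hbsign : ∀ i j, b i j = 1 ∨ b i j = -1 :=
    fromBlocks_sign onesMatrix_sign onesMatrix_sign onesMatrix_sign (neg_sign onesMatrix_sign)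
  have hcsign : ∀ i j, c i j = 1 ∨ c i j = -1 :=
    fromBlocks_sign onesMatrix_sign onesMatrix_sign onesMatrix_sign (neg_sign onesMatrix_sign)
  have hasign : ∀ i j, a i j = 1 ∨ a i j = -1 := by
    rintro (i | i) (j | j) <;> rcases hε with rfl | rfl <;> simp [a]
  have hasign' : ∀ i j, a' i j = 1 ∨ a' i j = -1 := by
    rintro (i | i) (j | j) <;> rcases hε with rfl | rfl <;> simp [a']
  refine IsComplexHadamardPair.order (X := borderedMatrix a b c U V)
    (Y := borderedMatrix a' b c U' V')
    ⟨borderedMatrix_sign hasign hbsign hcsign h.sign_left,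
      borderedMatrix_sign hasign' hbsign hcsign h.sign_right, ?_, ?_, ?_, ?_⟩
    (by rw [← hn]; simp only [Fintype.card_sum, Fintype.card_unit]; ring)
  · rw [borderedMatrix_transpose, ha, hb, hc, h.symm₁, h.symm₂]
  · rw [borderedMatrix_transpose, ha', hb, hc, h.symm₃, h.symm₄]
  · rw [borderedMatrix_mul, borderedMatrix_mul, h.comm_left, h.comm_right, hUc, hUc', hbU, hbU']
    congr 1
    · simp [a, a', fromBlocks_multiply, fromBlocks_smul]
    · simp only [a, a', b, fromBlocks_multiply, fromBlocks_smul, Matrix.smul_mul, Matrix.neg_mul,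
        Matrix.one_mul, Matrix.mul_neg, fromBlocks_add]
      congr 1 <;> module
    · simp only [a, a', c, fromBlocks_multiply, fromBlocks_smul, Matrix.mul_smul,
        Matrix.mul_one, Matrix.mul_neg, fromBlocks_add]
      congr 1 <;> module
  · have hN : (2 * (Fintype.card ((Unit ⊕ Unit) ⊕ ((ι ⊕ ι) ⊕ (ι ⊕ ι))) : ℤ))
        = 2 * (2 * (2 * (Fintype.card ι : ℤ) + 1)) := by
      simp only [Fintype.card_sum, Fintype.card_unit]
      push_cast
      ring
    rw [hN, ← borderedMatrix_smul_one, borderedMatrix_mul, borderedMatrix_mul, borderedMatrix_add,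
      hUc, hUc', hbU, hbU', eq_sub_of_add_eq h.sq_left, eq_sub_of_add_eq h.sq_right]
    congr 1
    · simp only [a, a', b, c, fromBlocks_multiply, fromBlocks_smul, Matrix.smul_mul,
        Matrix.mul_smul, smul_smul, hε2, Matrix.neg_mul, Matrix.one_mul, Matrix.mul_neg,
        fromBlocks_add, onesMatrix_mul_onesMatrix, onesMatrix_self, ← fromBlocks_one]
      rcases hε with rfl | rfl <;> congr 1 <;> module
    · simp only [a, a', b, fromBlocks_multiply, fromBlocks_smul, Matrix.smul_mul, Matrix.neg_mul,
        Matrix.one_mul, Matrix.mul_neg, fromBlocks_add, ← fromBlocks_zero]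
      congr 1 <;> module
    · simp only [a, a', c, fromBlocks_multiply, fromBlocks_smul, Matrix.mul_smul,
        Matrix.mul_one, Matrix.mul_neg, fromBlocks_add, ← fromBlocks_zero]
      congr 1 <;> module
    · have hcb : c * b = (2 : ℤ) • fromBlocks (onesMatrix ι ι) 0 0 (onesMatrix ι ι) := by
        simp only [b, c, fromBlocks_multiply, fromBlocks_smul, Matrix.neg_mul, Matrix.mul_neg,
          onesMatrix_mul_onesMatrix, Fintype.card_unit]
        congr 1
      rw [hcb]
      module
    · module

lemma IsPaleyPair.isBorderBlocks {M P K : Matrix ι ι ℤ} (h : IsPaleyPair M P)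
    (hK : IsSymmHadamard K) :
    IsBorderBlocks (-1) (fromBlocks M 0 0 (-P)) (fromBlocks 1 K K 0)
      (fromBlocks P 0 0 (-M)) (fromBlocks 0 K K (-1)) := by
  refine ⟨?_, ?_, ?_, ?_, ?_, ?_, ?_, ?_, ?_, ?_, ?_, ?_⟩
  · rintro (i | i) (j | j)
    · rcases eq_or_ne i j with rfl | hij
      · simp [h.diag]
      · simpa [hij] using h.sign_left i j hij
    · simpa using hK.sign i j
    · simpa using hK.sign i j
    · simpa [neg_eq_iff_eq_neg, or_comm] using h.sign_right i j
  · rintro (i | i) (j | j)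
    · simpa using h.sign_right i j
    · simpa using hK.sign i j
    · simpa using hK.sign i j
    · rcases eq_or_ne i j with rfl | hij
      · simp [h.diag]
      · simpa [hij, neg_eq_iff_eq_neg, or_comm] using h.sign_left i j hij
  · simp [fromBlocks_transpose, h.symm_left, h.symm_right]
  · simp [fromBlocks_transpose, hK.symm]
  · simp [fromBlocks_transpose, h.symm_left, h.symm_right]
  · simp [fromBlocks_transpose, hK.symm]
  · simp [fromBlocks_multiply, h.comm]
  · simp [fromBlocks_multiply]
  · simp [fromBlocks_multiply, h.left_mul_ones, h.right_mul_ones, fromBlocks_neg]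
  · simp [fromBlocks_multiply, h.left_mul_ones, h.right_mul_ones, fromBlocks_neg]
  · rw [← fromBlocks_one, fromBlocks_smul, fromBlocks_smul, fromBlocks_sub_fromBlocks]
    simp only [fromBlocks_multiply, fromBlocks_add, Matrix.mul_neg, Matrix.neg_mul,
      Matrix.mul_zero, Matrix.zero_mul, neg_neg, fromBlocks_inj, eq_sub_of_add_eq h.sq]
    refine ⟨?_, ?_, ?_, ?_⟩ <;> module
  · rw [← fromBlocks_one, fromBlocks_smul]
    simp only [fromBlocks_multiply, fromBlocks_add, Matrix.mul_neg, Matrix.neg_mul,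
      Matrix.mul_zero, Matrix.zero_mul, Matrix.mul_one, Matrix.one_mul, neg_neg, fromBlocks_inj,
      hK.sq]
    refine ⟨?_, ?_, ?_, ?_⟩ <;> module

lemma IsTurynPair.isBorderBlocks {A B S : Matrix ι ι ℤ} (h : IsTurynPair A B)
    (hS : IsSkewCore S) :
    IsBorderBlocks 1 (fromBlocks 1 S (-S) 0) (fromBlocks A 1 1 (-B))
      (fromBlocks 0 S (-S) (-1)) (fromBlocks B 1 1 (-A)) := by
  have hdiag : ∀ i, S i i = 0 := by
    intro i
    have := congrFun (congrFun hS.skew i) i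
    simp only [transpose_apply, Matrix.neg_apply] at this
    omega
  have hS1 : S * onesMatrix ι Unit = 0 := by rw [mul_onesMatrix_of_sum_eq hS.sum, zero_smul]
  have hSV : ∀ i j, (S i j = 0 ∧ ((1 : Matrix ι ι ℤ) i j = 1 ∨ (1 : Matrix ι ι ℤ) i j = -1)) ∨
      ((S i j = 1 ∨ S i j = -1) ∧ (1 : Matrix ι ι ℤ) i j = 0) := by
    intro i j
    rcases eq_or_ne i j with rfl | hij
    · simp [hdiag]
    · simpa [hij] using hS.sign i j hij
  refine ⟨?_, ?_, ?_, ?_, ?_, ?_, ?_, ?_, ?_, ?_, ?_, ?_⟩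
  · rintro (i | i) (j | j)
    · rcases eq_or_ne i j with rfl | hij
      · simp [h.diag]
      · simpa [hij] using h.sign_left i j hij
    · exact hSV i j
    · have := hSV i j
      simp only [fromBlocks_apply₂₁, Matrix.neg_apply]
      omega
    · simpa [neg_eq_iff_eq_neg, or_comm] using h.sign_right i j
  · rintro (i | i) (j | j)
    · simpa using h.sign_right i j
    · exact hSV i j
    · have := hSV i j
      simp only [fromBlocks_apply₂₁, Matrix.neg_apply]
      omega
    · rcases eq_or_ne i j with rfl | hij
      · simp [h.diag]
      · simpa [hij, neg_eq_iff_eq_neg, or_comm] using h.sign_left i j hij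
  · simp [fromBlocks_transpose, hS.skew]
  · simp [fromBlocks_transpose, h.symm_left, h.symm_right]
  · simp [fromBlocks_transpose, hS.skew]
  · simp [fromBlocks_transpose, h.symm_left, h.symm_right]
  · simp [fromBlocks_multiply]
  · simp only [fromBlocks_multiply, Matrix.mul_neg, Matrix.neg_mul, Matrix.mul_one,
      Matrix.one_mul, neg_neg, h.comm]
    congr 1 <;> module
  · simp [fromBlocks_multiply, hS1]
  · simp [fromBlocks_multiply, hS1]
  · rw [← fromBlocks_one, fromBlocks_smul, fromBlocks_smul, fromBlocks_sub_fromBlocks]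
    simp only [fromBlocks_multiply, fromBlocks_add, Matrix.mul_neg, Matrix.neg_mul,
      Matrix.mul_zero, Matrix.zero_mul, Matrix.mul_one, Matrix.one_mul, neg_neg, fromBlocks_inj,
      hS.sq]
    refine ⟨?_, ?_, ?_, ?_⟩ <;> module
  · rw [← fromBlocks_one, fromBlocks_smul]
    simp only [fromBlocks_multiply, fromBlocks_add, Matrix.mul_neg, Matrix.neg_mul,
      Matrix.mul_one, Matrix.one_mul, neg_neg, fromBlocks_inj, eq_sub_of_add_eq h.sq]
    refine ⟨?_, ?_, ?_, ?_⟩ <;> module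

lemma IsSkewConference.double {W : Matrix ι ι ℤ} (h : IsSkewConference W) :
    IsSkewConference (fromBlocks W (W + 1) (W - 1) (-W)) := by
  have hdiag : ∀ i, W i i = 0 := by
    intro i
    have := congrFun (congrFun h.skew i) i
    simp only [transpose_apply, Matrix.neg_apply] at this
    omega
  refine ⟨?_, ?_, ?_⟩
  · rintro (i | i) (j | j) hij
    · exact h.sign i j fun h => hij (congrArg _ h)
    · rcases eq_or_ne i j with rfl | hij
      · simp [hdiag]
      · simpa [hij] using h.sign i j hij
    · rcases eq_or_ne i j with rfl | hij
      · simp [hdiag]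
      · simpa [hij] using h.sign i j hij
    · simpa [neg_eq_iff_eq_neg, or_comm] using h.sign i j fun h => hij (congrArg _ h)
  · simp only [fromBlocks_transpose, transpose_add, transpose_sub, transpose_neg, transpose_one,
      h.skew, fromBlocks_neg]
    congr 1 <;> module
  · rw [← fromBlocks_one, fromBlocks_smul]
    simp only [fromBlocks_multiply, Matrix.mul_neg, Matrix.neg_mul, Matrix.mul_add,
      Matrix.add_mul, Matrix.mul_sub, Matrix.sub_mul, Matrix.mul_one, Matrix.one_mul, neg_neg,
      fromBlocks_inj, h.sq, Fintype.card_sum]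
    push_cast
    refine ⟨?_, ?_, ?_, ?_⟩ <;> module

lemma exists_isSkewConference_two_pow (k : ℕ) :
    ∃ W : Matrix (Fin (2 ^ k)) (Fin (2 ^ k)) ℤ, IsSkewConference W := by
  induction k with
  | zero =>
    refine ⟨0, fun i j hij => absurd (Subsingleton.elim (α := Fin 1) i j) hij, by simp, by simp⟩
  | succ k ih =>
    obtain ⟨W, hW⟩ := ih
    let e : Fin (2 ^ (k + 1)) ≃ Fin (2 ^ k) ⊕ Fin (2 ^ k) :=
      Fintype.equivOfCardEq (by simp [pow_succ, mul_two])
    have h := hW.double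
    refine ⟨(fromBlocks W (W + 1) (W - 1) (-W)).submatrix e e,
      fun i j hij => h.sign _ _ (e.injective.ne hij), ?_, ?_⟩
    · rw [transpose_submatrix, h.skew]
      rfl
    · rw [submatrix_mul_equiv, ← submatrix_one_equiv e, Fintype.card_congr e]
      exact congrArg (fun A : Matrix _ _ ℤ => A.submatrix e e) h.sq

lemma IsSkewConference.isSkewCore {n : ℕ} {W : Matrix (Fin (n + 1)) (Fin (n + 1)) ℤ}
    (h : IsSkewConference W) :
    IsSkewCore (of fun i j : Fin n => W 0 i.succ * W 0 j.succ * W i.succ j.succ) := by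
  have h0 : ∀ i : Fin n, W 0 i.succ * W 0 i.succ = 1 := by
    intro i
    rcases h.sign 0 i.succ (Fin.succ_ne_zero i).symm with h | h <;> simp [h]
  have hskew : ∀ i j, W j i = -W i j := fun i j => congrFun (congrFun h.skew i) j
  have h00 : W 0 0 = 0 := by
    have := hskew 0 0
    omega
  have hsq : ∀ i j, ∑ k : Fin n, W i k.succ * W k.succ j =
      (if i = j then -(n : ℤ) else 0) - W i 0 * W 0 j := by
    intro i j
    have h1 : (W * W) i j = if i = j then -(n : ℤ) else 0 := by
      rw [h.sq, Matrix.smul_apply, one_apply]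
      split_ifs <;> simp
    rw [mul_apply, Fin.sum_univ_succ] at h1
    linarith
  refine ⟨?_, ?_, ?_, ?_⟩
  · intro i j hij
    simp only [of_apply]
    rcases h.sign 0 i.succ (Fin.succ_ne_zero i).symm with h1 | h1 <;>
    rcases h.sign 0 j.succ (Fin.succ_ne_zero j).symm with h2 | h2 <;>
    rcases h.sign i.succ j.succ ((Fin.succ_injective n).ne hij) with h3 | h3 <;>
    simp [h1, h2, h3]
  · ext i j
    simp only [transpose_apply, of_apply, Matrix.neg_apply, hskew i.succ j.succ]
    ring
  · intro i
    have h1 := hsq 0 i.succ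
    rw [if_neg (Fin.succ_ne_zero i).symm, h00] at h1
    simp only [of_apply]
    calc ∑ j : Fin n, W 0 i.succ * W 0 j.succ * W i.succ j.succ
        = -W 0 i.succ * ∑ j : Fin n, W 0 j.succ * W j.succ i.succ := by
          rw [mul_sum]
          refine sum_congr rfl fun j _ => ?_
          rw [hskew i.succ j.succ]
          ring
      _ = 0 := by rw [h1]; ring
  · ext i j
    have h1 := hsq i.succ j.succ
    simp only [mul_apply, of_apply, Matrix.sub_apply, Matrix.smul_apply, one_apply, onesMatrix,
      Fintype.card_fin]
    calc ∑ k : Fin n, W 0 i.succ * W 0 k.succ * W i.succ k.succ *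
          (W 0 k.succ * W 0 j.succ * W k.succ j.succ)
        = W 0 i.succ * W 0 j.succ * ∑ k : Fin n, W i.succ k.succ * W k.succ j.succ := by
          rw [mul_sum]
          refine sum_congr rfl fun k _ => ?_
          linear_combination (W 0 i.succ * W 0 j.succ * W i.succ k.succ * W k.succ j.succ) * h0 k
      _ = _ := by
          rw [h1, hskew 0 i.succ]
          rcases eq_or_ne i j with rfl | hij
          · simp only [if_true]
            linear_combination (-(n : ℤ) + W 0 i.succ * W 0 i.succ + 1) * h0 i
          · rw [if_neg ((Fin.succ_injective n).ne hij), if_neg hij]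
            linear_combination (W 0 j.succ * W 0 j.succ) * h0 i + h0 j

end Constructions

section Orders

variable (F : Type*) [Field F] [Fintype F]

lemma complexHadamardOrder_card_add_one {n : ℕ} (hF : Fintype.card F % 4 = 1)
    (hn : Fintype.card F + 1 = n) : ComplexHadamardOrder n := by
  classical
  obtain ⟨M, P, h, hcard⟩ := exists_isPaleyPair hF
  refine h.isTurynPair.complexHadamardOrder ?_
  rw [Fintype.card_sum, Fintype.card_unit]
  omega

lemma ComplexHadamardOrder.williamsonType {n q : ℕ} (h : ComplexHadamardOrder n)
    (hF : Fintype.card F = q) (hq : q % 4 = 1) (hn : q = 2 * n + 1) : WilliamsonType q := by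
  classical
  obtain ⟨M, P, hMP, hcard⟩ := exists_isPaleyPair (F := F) (by omega)
  obtain ⟨X, Y, hXY⟩ := h
  exact hMP.williamsonType (hXY.submatrix (Fintype.equivFinOfCardEq (by omega))) (by omega)

lemma ComplexHadamardOrder.two_mul_card {n m : ℕ} (h : ComplexHadamardOrder n)
    (hF : Fintype.card F % 4 = 1) (hn : Fintype.card F = 4 * n + 1)
    (hm : m = 2 * Fintype.card F) : ComplexHadamardOrder m := by
  classical
  obtain ⟨M, P, hMP, hcard⟩ := exists_isPaleyPair hF
  obtain ⟨K, hK⟩ := h.exists_isSymmHadamard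
    (ι := {u : F // quadraticChar F u = 1}) (by omega)
  exact (hMP.isBorderBlocks hK).complexHadamardOrder (Or.inr rfl) (by omega)

lemma SkewCoreOrder.complexHadamardOrder {r m : ℕ} (h : SkewCoreOrder r)
    (hF : Fintype.card F % 4 = 1) (hr : Fintype.card F + 1 = 2 * r)
    (hm : m = 2 * (Fintype.card F + 2)) : ComplexHadamardOrder m := by
  classical
  obtain ⟨M, P, hMP, hcard⟩ := exists_isPaleyPair hF
  obtain ⟨S, hS⟩ := h
  have hcard' : Fintype.card (Unit ⊕ {u : F // quadraticChar F u = 1}) = r := by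
    rw [Fintype.card_sum, Fintype.card_unit]
    omega
  exact (hMP.isTurynPair.isBorderBlocks (hS.submatrix (Fintype.equivFinOfCardEq hcard'))
    ).complexHadamardOrder (Or.inl rfl) (by omega)

end Orders

theorem williamsonType_509 : WilliamsonType 509 := by
  have : Fact (Nat.Prime 509) := ⟨by norm_num⟩
  have : Fact (Nat.Prime 5) := ⟨by norm_num⟩
  let _ : Fintype (GaloisField 5 3) := Fintype.ofFinite _
  have hF : Fintype.card (GaloisField 5 3) = 125 := by
    rw [← Nat.card_eq_fintype_card, GaloisField.card _ _ (by norm_num)]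
    norm_num
  have hcore : SkewCoreOrder 63 := by
    obtain ⟨W, hW⟩ := exists_isSkewConference_two_pow 6
    exact ⟨_, IsSkewConference.isSkewCore (n := 63) hW⟩
  have h := hcore.complexHadamardOrder (m := 254) (GaloisField 5 3) (by rw [hF]) (by rw [hF])
    (by rw [hF])
  exact h.williamsonType (ZMod 509) (ZMod.card 509) (by norm_num) (by norm_num)

theorem williamsonType_2389 : WilliamsonType 2389 := by
  have : Fact (Nat.Prime 2389) := ⟨by norm_num⟩
  have : Fact (Nat.Prime 1193) := ⟨by norm_num⟩
  have h := complexHadamardOrder_card_add_one (n := 1194) (ZMod 1193) (by rw [ZMod.card])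
    (by rw [ZMod.card])
  exact h.williamsonType (ZMod 2389) (ZMod.card 2389) (by norm_num) (by norm_num)

theorem williamsonType_2693 : WilliamsonType 2693 := by
  have : Fact (Nat.Prime 2693) := ⟨by norm_num⟩
  have : Fact (Nat.Prime 673) := ⟨by norm_num⟩
  have : Fact (Nat.Prime 41) := ⟨by norm_num⟩
  have h := complexHadamardOrder_card_add_one (n := 42) (ZMod 41) (by rw [ZMod.card])
    (by rw [ZMod.card])
  have h' := h.double.double.two_mul_card (m := 1346) (ZMod 673) (by rw [ZMod.card])
    (by rw [ZMod.card]) (by rw [ZMod.card])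
  exact h'.williamsonType (ZMod 2693) (ZMod.card 2693) (by norm_num) (by norm_num)

theorem williamsonType_2917 : WilliamsonType 2917 := by
  have : Fact (Nat.Prime 2917) := ⟨by norm_num⟩
  have : Fact (Nat.Prime 181) := ⟨by norm_num⟩
  have : Fact (Nat.Prime 3) := ⟨by norm_num⟩
  let _ : Fintype (GaloisField 3 6) := Fintype.ofFinite _
  have hF : Fintype.card (GaloisField 3 6) = 729 := by
    rw [← Nat.card_eq_fintype_card, GaloisField.card _ _ (by norm_num)]
    norm_num
  have h := complexHadamardOrder_card_add_one (n := 182) (ZMod 181) (by rw [ZMod.card])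
    (by rw [ZMod.card])
  have h' := h.two_mul_card (m := 1458) (GaloisField 3 6) (by rw [hF]) (by rw [hF]) (by rw [hF])
  exact h'.williamsonType (ZMod 2917) (ZMod.card 2917) (by norm_num) (by norm_num)

theorem williamsonType_3037 : WilliamsonType 3037 := by
  have : Fact (Nat.Prime 3037) := ⟨by norm_num⟩
  have : Fact (Nat.Prime 757) := ⟨by norm_num⟩
  have : Fact (Nat.Prime 379) := ⟨by norm_num⟩
  have hcore : SkewCoreOrder 379 :=
    (isSkewCore_quadraticChar (F := ZMod 379) (by rw [ZMod.card])).order (ZMod.card 379)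
  have h := hcore.complexHadamardOrder (m := 1518) (ZMod 757) (by rw [ZMod.card])
    (by rw [ZMod.card]) (by rw [ZMod.card])
  exact h.williamsonType (ZMod 3037) (ZMod.card 3037) (by norm_num) (by norm_num)

theorem williamson_prop3 (q : ℕ) (hq : q ∈ ({509, 2389, 2693, 2917, 3037} : Finset ℕ)) :
    WilliamsonType q := by
  simp only [Finset.mem_insert, Finset.mem_singleton] at hq
  rcases hq with rfl | rfl | rfl | rfl | rfl
  · exact williamsonType_509
  · exact williamsonType_2389
  · exact williamsonType_2693
  · exact williamsonType_2917
  · exact williamsonType_3037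
end

section
/- If there exist Williamson-type matrices of order m and T-sequences of length d, then there exists a Hadamard matrix of order 4dm. -/
/-- Nonperiodic autocorrelation of the length-`m` sequence `X 0, …, X (m-1)`:
`N_X(j) = ∑_{i} X i * X (i + j)` over `i < m - j`. -/
def NAC (m : ℕ) (X : ℕ → ℤ) (j : ℕ) : ℤ :=
  ∑ i ∈ Finset.range (m - j), X i * X (i + j)
/-- T-sequences of length `n`: four `{0, ±1}`-sequences such that at each position
`i < n` exactly one of them is nonzero, and whose nonperiodic autocorrelations
sum to zero for all shifts `j ≥ 1`. -/
def TSeq (n : ℕ) : Prop :=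
  ∃ T₁ T₂ T₃ T₄ : ℕ → ℤ,
    (∀ i < n, T₁ i = 0 ∨ T₁ i = 1 ∨ T₁ i = -1) ∧
    (∀ i < n, T₂ i = 0 ∨ T₂ i = 1 ∨ T₂ i = -1) ∧
    (∀ i < n, T₃ i = 0 ∨ T₃ i = 1 ∨ T₃ i = -1) ∧
    (∀ i < n, T₄ i = 0 ∨ T₄ i = 1 ∨ T₄ i = -1) ∧
    (∀ i < n,
      (T₁ i ≠ 0 ∧ T₂ i = 0 ∧ T₃ i = 0 ∧ T₄ i = 0) ∨
      (T₁ i = 0 ∧ T₂ i ≠ 0 ∧ T₃ i = 0 ∧ T₄ i = 0) ∨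
      (T₁ i = 0 ∧ T₂ i = 0 ∧ T₃ i ≠ 0 ∧ T₄ i = 0) ∨
      (T₁ i = 0 ∧ T₂ i = 0 ∧ T₃ i = 0 ∧ T₄ i ≠ 0)) ∧
    ∀ j, 1 ≤ j → NAC n T₁ j + NAC n T₂ j + NAC n T₃ j + NAC n T₄ j = 0

namespace GoethalsSeidel

open Matrix

variable {G : Type*} [AddCommGroup G]

/-- The back-circulant matrix `(a, b) ↦ v (a + b)`. -/
def backCirculant (v : G → ℤ) : Matrix G G ℤ := Matrix.of fun a b => v (a + b)

theorem backCirculant_transpose (v : G → ℤ) : (backCirculant v)ᵀ = backCirculant v := by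
  ext a b
  simp [backCirculant, add_comm]

section Products

variable [Fintype G]

theorem backCirculant_mul_circulant (v w : G → ℤ) :
    backCirculant v * circulant w = circulant (fun i => w (-i)) * backCirculant v := by
  ext a b
  simp only [mul_apply, circulant_apply, backCirculant, of_apply]
  refine Fintype.sum_equiv (Equiv.addRight (a - b)) _ _ fun c => ?_
  simp only [Equiv.coe_addRight]
  rw [mul_comm]
  congr 2 <;> abel

theorem backCirculant_mul_backCirculant (v w : G → ℤ) :
    backCirculant v * backCirculant w = circulant v * circulant (fun i => w (-i)) := by
  ext a b
  simp only [mul_apply, circulant_apply, backCirculant, of_apply]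
  refine Fintype.sum_equiv (Equiv.neg G) _ _ fun c => ?_
  simp only [Equiv.neg_apply]
  congr 2 <;> abel

end Products

/-- The blocks of the Goethals–Seidel array on the circulants with first columns `x 0, …, x 3`. -/
def block (x : Fin 4 → G → ℤ) : Fin 4 → Fin 4 → Matrix G G ℤ :=
  ![![circulant (x 0), backCirculant (x 1), backCirculant (x 2), backCirculant (x 3)],
    ![-backCirculant (x 1), circulant (x 0), backCirculant (fun i => x 3 (-i)),
      -backCirculant (fun i => x 2 (-i))],
    ![-backCirculant (x 2), -backCirculant (fun i => x 3 (-i)), circulant (x 0),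
      backCirculant (fun i => x 1 (-i))],
    ![-backCirculant (x 3), backCirculant (fun i => x 2 (-i)),
      -backCirculant (fun i => x 1 (-i)), circulant (x 0)]]

/-- The Goethals–Seidel array. -/
def array (x : Fin 4 → G → ℤ) : Matrix (Fin 4 × G) (Fin 4 × G) ℤ :=
  Matrix.of fun p q => block x p.1 q.1 p.2 q.2

/-- Each entry of the array is, up to sign, a fixed entry of a fixed sequence. -/
theorem exists_array_apply_eq (p q : Fin 4 × G) :
    ∃ (ε : ℤ) (l : Fin 4) (g : G), (ε = 1 ∨ ε = -1) ∧ ∀ x, array x p q = ε * x l g := by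
  obtain ⟨i, a⟩ := p
  obtain ⟨j, b⟩ := q
  have pos (l : Fin 4) (g : G) (h : ∀ x, array x (i, a) (j, b) = x l g) :
      ∃ (ε : ℤ) (l : Fin 4) (g : G),
        (ε = 1 ∨ ε = -1) ∧ ∀ x, array x (i, a) (j, b) = ε * x l g :=
    ⟨1, l, g, Or.inl rfl, fun x => by rw [h, one_mul]⟩
  have neg (l : Fin 4) (g : G) (h : ∀ x, array x (i, a) (j, b) = -x l g) :
      ∃ (ε : ℤ) (l : Fin 4) (g : G),
        (ε = 1 ∨ ε = -1) ∧ ∀ x, array x (i, a) (j, b) = ε * x l g :=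
    ⟨-1, l, g, Or.inr rfl, fun x => by rw [h, neg_one_mul]⟩
  fin_cases i <;> fin_cases j <;>
    first
      | exact pos _ _ fun x => rfl
      | exact neg _ _ fun x => rfl

variable [Fintype G]

theorem array_mul_transpose_apply (x y : Fin 4 → G → ℤ) (i j : Fin 4) (a b : G) :
    (array x * (array y)ᵀ) (i, a) (j, b) = (∑ k, block x i k * (block y j k)ᵀ) a b := by
  simp [array, mul_apply, Fintype.sum_prod_type, Matrix.sum_apply]

theorem sum_block_mul_transpose (x y : Fin 4 → G → ℤ) (i j : Fin 4) :
    ∑ k, block x i k * (block y j k)ᵀ + ∑ k, block y i k * (block x j k)ᵀ =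
      if i = j then
        ∑ l, (circulant (x l) * (circulant (y l))ᵀ + circulant (y l) * (circulant (x l))ᵀ)
      else 0 := by
  fin_cases i <;> fin_cases j <;>
    simp [block, Fin.sum_univ_four, transpose_circulant, backCirculant_transpose,
      backCirculant_mul_backCirculant, backCirculant_mul_circulant, circulant_mul_comm] <;> abel

theorem array_mul_transpose_add [DecidableEq G] {x y : Fin 4 → G → ℤ} {c : ℤ}
    (h : ∑ l, (circulant (x l) * (circulant (y l))ᵀ + circulant (y l) * (circulant (x l))ᵀ) =
      c • (1 : Matrix G G ℤ)) :
    array x * (array y)ᵀ + array y * (array x)ᵀ = c • 1 := by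
  ext ⟨i, a⟩ ⟨j, b⟩
  rw [Matrix.add_apply, array_mul_transpose_apply, array_mul_transpose_apply,
    ← Matrix.add_apply, sum_block_mul_transpose, h]
  by_cases hij : i = j <;> simp [hij, Matrix.one_apply]

/-- The Cooper–Wallis coefficients: row `k` lists the multiples of the `k`-th variable in the four
circulants substituted into the Goethals–Seidel array. -/
def cooperWallis {R : Type*} [Neg R] (t : Fin 4 → R) : Fin 4 → Fin 4 → R :=
  ![![t 0, t 1, t 2, t 3],
    ![t 1, -t 0, -t 3, t 2],
    ![t 2, t 3, -t 0, -t 1],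
    ![t 3, -t 2, t 1, -t 0]]

theorem sum_cooperWallis_mul_transpose [DecidableEq G] {t : Fin 4 → G → ℤ} {c : ℤ}
    (h : ∑ l, circulant (t l) * (circulant (t l))ᵀ = c • (1 : Matrix G G ℤ)) (k k' : Fin 4) :
    ∑ l, (circulant (cooperWallis t k l) * (circulant (cooperWallis t k' l))ᵀ +
      circulant (cooperWallis t k' l) * (circulant (cooperWallis t k l))ᵀ) =
      (if k = k' then 2 * c else 0) • (1 : Matrix G G ℤ) := by
  have h2 : (2 * c) • (1 : Matrix G G ℤ) = ∑ l, circulant (t l) * (circulant (t l))ᵀ +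
      ∑ l, circulant (t l) * (circulant (t l))ᵀ := by rw [h, ← add_smul, two_mul]
  rw [ite_smul, h2]
  fin_cases k <;> fin_cases k' <;>
    simp [cooperWallis, Fin.sum_univ_four, circulant_neg] <;> abel

end GoethalsSeidel

/-- A vector with a single nonzero entry, which is `±1`. -/
def IsSignedUnit {ι : Type*} (f : ι → ℤ) : Prop :=
  ∃ k, (f k = 1 ∨ f k = -1) ∧ ∀ l, l ≠ k → f l = 0

theorem IsSignedUnit.cooperWallis {t : Fin 4 → ℤ} (ht : IsSignedUnit t) (l : Fin 4) :
    IsSignedUnit fun k => GoethalsSeidel.cooperWallis t k l := by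
  obtain ⟨i, hi, h0⟩ := ht
  simp only [Fin.forall_fin_succ, IsSignedUnit, Fin.exists_fin_succ] at *
  fin_cases i <;> fin_cases l <;> simp_all [GoethalsSeidel.cooperWallis] <;> omega

theorem IsSignedUnit.sum_mul {ι : Type*} [Fintype ι] {f a : ι → ℤ} (hf : IsSignedUnit f)
    (ha : ∀ k, a k = 1 ∨ a k = -1) : ∑ k, f k * a k = 1 ∨ ∑ k, f k * a k = -1 := by
  obtain ⟨k, hk, h0⟩ := hf
  rw [Fintype.sum_eq_single k fun l hl => by rw [h0 l hl, zero_mul]]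
  rcases hk with hk | hk <;> rcases ha k with h | h <;> simp [hk, h]

theorem IsSignedUnit.const_mul {ι : Type*} {f : ι → ℤ} (hf : IsSignedUnit f) {ε : ℤ}
    (hε : ε = 1 ∨ ε = -1) : IsSignedUnit fun k => ε * f k := by
  obtain ⟨k, hk, h0⟩ := hf
  refine ⟨k, ?_, fun l hl => by simp [h0 l hl]⟩
  rcases hk with hk | hk <;> rcases hε with h | h <;> simp [hk, h]

theorem IsSignedUnit.sum_mul_self {ι : Type*} [Fintype ι] {f : ι → ℤ} (hf : IsSignedUnit f) :
    ∑ k, f k * f k = 1 := by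
  obtain ⟨k, hk, h0⟩ := hf
  rw [Fintype.sum_eq_single k fun l hl => by rw [h0 l hl, zero_mul]]
  rcases hk with hk | hk <;> simp [hk]

open Matrix in
/-- Substituting pairwise amicable matrices for the variables of an orthogonal design. -/
theorem sum_kronecker_mul_transpose {ι κ μ : Type*} [Fintype ι] [Fintype κ] [Fintype μ]
    [DecidableEq ι] [DecidableEq κ] [DecidableEq μ] {P : κ → Matrix ι ι ℤ} {A : κ → Matrix μ μ ℤ}
    {c e : ℤ}
    (hP : ∀ k l, P k * (P l)ᵀ + P l * (P k)ᵀ = (if k = l then 2 * c else 0) • (1 : Matrix ι ι ℤ))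
    (hA : ∀ k l, A k * (A l)ᵀ = A l * (A k)ᵀ)
    (hsum : ∑ k, A k * (A k)ᵀ = e • (1 : Matrix μ μ ℤ)) :
    (∑ k, kroneckerMap (· * ·) (P k) (A k)) * (∑ k, kroneckerMap (· * ·) (P k) (A k))ᵀ =
      (c * e) • 1 := by
  have hexp : (∑ k, kroneckerMap (· * ·) (P k) (A k)) *
      (∑ k, kroneckerMap (· * ·) (P k) (A k))ᵀ =
      ∑ k, ∑ l, kroneckerMap (· * ·) (P k * (P l)ᵀ) (A k * (A l)ᵀ) := by
    rw [transpose_sum, Finset.sum_mul_sum]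
    refine Finset.sum_congr rfl fun k _ => Finset.sum_congr rfl fun l _ => ?_
    rw [mul_kronecker_mul, kroneckerMap_transpose]
  have hswap : ∑ k, ∑ l, kroneckerMap (· * ·) (P k * (P l)ᵀ) (A k * (A l)ᵀ) =
      ∑ k, ∑ l, kroneckerMap (· * ·) (P l * (P k)ᵀ) (A k * (A l)ᵀ) := by
    rw [Finset.sum_comm]
    refine Finset.sum_congr rfl fun k _ => Finset.sum_congr rfl fun l _ => ?_
    rw [hA]
  have htwo : (2 : ℤ) • ∑ k, ∑ l, kroneckerMap (· * ·) (P k * (P l)ᵀ) (A k * (A l)ᵀ) =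
      (2 : ℤ) • ((c * e) • (1 : Matrix (ι × μ) (ι × μ) ℤ)) := by
    rw [two_smul]
    nth_rewrite 2 [hswap]
    simp only [← Finset.sum_add_distrib, ← add_kronecker, hP]
    have hite (k l : κ) :
        kroneckerMap (· * ·) ((if k = l then 2 * c else 0) • (1 : Matrix ι ι ℤ)) (A k * (A l)ᵀ) =
          if k = l then (2 * c) • kroneckerMap (· * ·) (1 : Matrix ι ι ℤ) (A k * (A l)ᵀ)
          else 0 := by
      split_ifs
      · rw [smul_kronecker]
      · rw [zero_smul, zero_kronecker]
    simp only [hite, Finset.sum_ite_eq, Finset.mem_univ, if_true]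
    rw [← Finset.smul_sum]
    have : ∑ k, kroneckerMap (· * ·) (1 : Matrix ι ι ℤ) (A k * (A k)ᵀ) =
        kroneckerMap (· * ·) (1 : Matrix ι ι ℤ) (∑ k, A k * (A k)ᵀ) := by
      ext p q
      simp [Matrix.sum_apply, Finset.mul_sum]
    rw [this, hsum, kronecker_smul, one_kronecker_one, smul_smul, smul_smul, mul_assoc]
  rw [hexp]
  exact smul_right_injective _ two_ne_zero htwo

/-- The periodic autocorrelation is the sum of two nonperiodic ones. -/
theorem sum_mul_add_mod_eq_NAC_add_NAC (X : ℕ → ℤ) {d s : ℕ} (hs : s < d) :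
    ∑ i ∈ Finset.range d, X i * X ((i + s) % d) = NAC d X s + NAC d X (d - s) := by
  obtain ⟨r, rfl⟩ := Nat.exists_eq_add_of_le' hs.le
  have h1 : r + s - s = r := by omega
  have h2 : r + s - r = s := by omega
  rw [NAC, NAC, h1, h2, Finset.sum_range_add]
  congr 1
  · refine Finset.sum_congr rfl fun i hi => ?_
    rw [Nat.mod_eq_of_lt (by simpa using hi)]
  · refine Finset.sum_congr rfl fun i hi => ?_
    have hi' : i < s := Finset.mem_range.1 hi
    rw [show r + i + s = i + (r + s) by omega, Nat.add_mod_right, Nat.mod_eq_of_lt (by omega),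
      mul_comm, add_comm r i]

theorem circulant_mul_transpose_apply {d : ℕ} [NeZero d] (X : ℕ → ℤ) (a b : Fin d) :
    (Matrix.circulant (fun i : Fin d => X i) *
      (Matrix.circulant (fun i : Fin d => X i)).transpose) a b =
      ∑ i ∈ Finset.range d, X i * X ((i + (b - a : Fin d)) % d) := by
  rw [Matrix.mul_apply, ← Fin.sum_univ_eq_sum_range fun i => X i * X ((i + (b - a : Fin d)) % d)]
  refine Fintype.sum_equiv (Equiv.subLeft a) _ _ fun c => ?_
  simp only [Matrix.circulant_apply, Matrix.transpose_apply, Equiv.subLeft_apply, ← Fin.val_add]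
  congr 3
  abel_nf

theorem sum_circulant_mul_transpose {d : ℕ} [NeZero d] {T : Fin 4 → ℕ → ℤ}
    (hunit : ∀ i < d, IsSignedUnit fun k => T k i)
    (hN : ∀ j, 1 ≤ j → ∑ k, NAC d (T k) j = 0) :
    ∑ k, Matrix.circulant (fun i : Fin d => T k i) *
      (Matrix.circulant (fun i : Fin d => T k i)).transpose =
      (d : ℤ) • (1 : Matrix (Fin d) (Fin d) ℤ) := by
  ext a b
  simp only [Matrix.sum_apply, circulant_mul_transpose_apply]
  by_cases hab : a = b
  · subst hab
    rw [Finset.sum_comm, Finset.sum_congr rfl (g := fun _ => (1 : ℤ))]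
    · simp
    · intro i hi
      have hi' := Finset.mem_range.1 hi
      simpa [Nat.mod_eq_of_lt hi'] using (hunit i hi').sum_mul_self
  · have hs : ((b - a : Fin d) : ℕ) ≠ 0 := by
      simpa [Fin.val_eq_zero_iff, sub_eq_zero] using Ne.symm hab
    have hlt := (b - a).isLt
    simp only [sum_mul_add_mod_eq_NAC_add_NAC _ hlt, Finset.sum_add_distrib]
    rw [hN _ (by omega), hN _ (by omega)]
    simp [hab]

theorem IsHadamard.exists_of_equiv {ι : Type*} [Fintype ι] [DecidableEq ι] {n : ℕ}
    (e : ι ≃ Fin n) {H : Matrix ι ι ℤ} (hentry : ∀ i j, H i j = 1 ∨ H i j = -1)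
    (hH : H * H.transpose = (n : ℤ) • (1 : Matrix ι ι ℤ)) :
    ∃ H' : Matrix (Fin n) (Fin n) ℤ, IsHadamard n H' := by
  refine ⟨H.submatrix e.symm e.symm, fun i j => hentry _ _, ?_⟩
  rw [Matrix.transpose_submatrix, Matrix.submatrix_mul_equiv, hH, Matrix.submatrix_smul]
  simp

theorem exists_isHadamard_of_families {m d : ℕ} {W : Fin 4 → Matrix (Fin m) (Fin m) ℤ}
    {T : Fin 4 → ℕ → ℤ} (hentry : ∀ k i j, W k i j = 1 ∨ W k i j = -1)
    (hamic : ∀ k l, W k * (W l).transpose = W l * (W k).transpose)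
    (hsum : ∑ k, W k * (W k).transpose = ((4 * m : ℕ) : ℤ) • (1 : Matrix (Fin m) (Fin m) ℤ))
    (hunit : ∀ i < d, IsSignedUnit fun k => T k i)
    (hN : ∀ j, 1 ≤ j → ∑ k, NAC d (T k) j = 0) :
    ∃ H : Matrix (Fin (4 * d * m)) (Fin (4 * d * m)) ℤ, IsHadamard (4 * d * m) H := by
  rcases Nat.eq_zero_or_pos d with rfl | hd
  · have : IsEmpty (Fin (4 * 0 * m)) := by
      rw [mul_zero, zero_mul]
      infer_instance
    exact ⟨0, fun i => isEmptyElim i, Subsingleton.elim _ _⟩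
  have : NeZero d := ⟨hd.ne'⟩
  let t : Fin 4 → Fin d → ℤ := fun k i => T k i
  have hP (k l : Fin 4) := GoethalsSeidel.array_mul_transpose_add
    (GoethalsSeidel.sum_cooperWallis_mul_transpose (t := t)
      (sum_circulant_mul_transpose hunit hN) k l)
  have hcard : Fintype.card ((Fin 4 × Fin d) × Fin m) = 4 * d * m := by simp
  refine IsHadamard.exists_of_equiv (Fintype.equivFinOfCardEq hcard) ?_
    ((sum_kronecker_mul_transpose hP hamic hsum).trans ?_)
  · rintro ⟨p, i⟩ ⟨q, j⟩
    obtain ⟨ε, l, g, hε, hx⟩ := GoethalsSeidel.exists_array_apply_eq p q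
    have hcw : (fun k => GoethalsSeidel.cooperWallis t k l g) =
        fun k => GoethalsSeidel.cooperWallis (fun k => t k g) k l := by
      funext k
      fin_cases k <;> fin_cases l <;> rfl
    have hu : IsSignedUnit fun k =>
        GoethalsSeidel.array (GoethalsSeidel.cooperWallis t k) p q := by
      simp only [hx]
      refine IsSignedUnit.const_mul ?_ hε
      rw [hcw]
      exact (hunit g g.isLt).cooperWallis l
    simpa [Matrix.sum_apply] using hu.sum_mul fun k => hentry k i j
  · congr 1
    push_cast
    ring

theorem williamson_tseq_hadamard (m d : ℕ)
    (hW : WilliamsonType m) (hT : TSeq d) :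
    ∃ H : Matrix (Fin (4 * d * m)) (Fin (4 * d * m)) ℤ,
      IsHadamard (4 * d * m) H := by
  obtain ⟨A, B, C, D, hA, hB, hC, hD, hAB, hAC, hAD, hBC, hBD, hCD, hsum⟩ := hW
  obtain ⟨T₁, T₂, T₃, T₄, h1, h2, h3, h4, hone, hN⟩ := hT
  refine exists_isHadamard_of_families (W := ![A, B, C, D]) (T := ![T₁, T₂, T₃, T₄])
    ?_ ?_ ?_ ?_ ?_
  · simpa [Fin.forall_fin_succ] using ⟨hA, hB, hC, hD⟩
  · simp [Fin.forall_fin_succ, hAB, hAC, hAD, hBC, hBD, hCD]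
  · simpa [Fin.sum_univ_four] using hsum
  · intro i hi
    have e1 := h1 i hi
    have e2 := h2 i hi
    have e3 := h3 i hi
    have e4 := h4 i hi
    simp only [IsSignedUnit, Fin.exists_fin_succ, Fin.forall_fin_succ]
    rcases hone i hi with h | h | h | h <;> simp_all
  · simpa [Fin.sum_univ_four] using hN
end
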